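/- Let m be a compactly supported function on ℝ² such that for every (x₀,y₀) in its support, m(x₀+x,y₀+y) = α(x,y) g(x,y) near (0,0) with g of the standard form and α bounded with |∇α(x,y)| ≤ A(x²+y²)^{−1/2}. Suppose 1 < p ≤ ∞ is such that for each such (x₀,y₀) the associated function g lies in L^p(N) for some neighborhood N of the origin, and let p' satisfy 1/p + 1/p' = 1. Let K(t,u) = ∫_{ℝ²} m(x,y) e^{i(tx+uy)} dx dy. Then there is a constant C depending on m and p such that |K(t,u)| ≤ C (2+|(t,u)|)^{−1/p'} for all (t,u) when p < ∞, and |K(t,u)| ≤ C (2+|(t,u)|)^{−1} ln(2+|(t,u)|) when p = ∞. -/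

import Mathlib

open MeasureTheory Real Set Filter Metric
open scoped Topology ENNReal

noncomputable section

/-- The Euclidean magnitude `|(x,y)| = √(x²+y²)` of a point of `ℝ²`. -/
def nrm2 (p : ℝ × ℝ) : ℝ := Real.sqrt (p.1 ^ 2 + p.2 ^ 2)

/-- The open Euclidean disk `{(x,y) : x²+y² < r²}` centered at the origin. -/
def disk2 (r : ℝ) : Set (ℝ × ℝ) := {p : ℝ × ℝ | p.1 ^ 2 + p.2 ^ 2 < r ^ 2}

/-- The closed Euclidean disk `{(x,y) : x²+y² ≤ r²}` centered at the origin. -/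
def closedDisk2 (r : ℝ) : Set (ℝ × ℝ) := {p : ℝ × ℝ | p.1 ^ 2 + p.2 ^ 2 ≤ r ^ 2}

/-- The circle `{(x,y) : x²+y² = r²}` centered at the origin. -/
def circle2 (r : ℝ) : Set (ℝ × ℝ) := {p : ℝ × ℝ | p.1 ^ 2 + p.2 ^ 2 = r ^ 2}

/-- Dot product on `ℝ²`. -/
def dot2 (p q : ℝ × ℝ) : ℝ := p.1 * q.1 + p.2 * q.2

/-- The perpendicular vector `v^⊥ = (v₂, −v₁)`. -/
def perp2 (v : ℝ × ℝ) : ℝ × ℝ := (v.2, -v.1)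

/-- The function `g = χ_E · ∏ᵢ |fᵢ|^(γᵢ)`. -/
def stdFun (n : ℕ) (f : Fin n → ℝ × ℝ → ℝ) (γ : Fin n → ℝ) (E : Set (ℝ × ℝ)) :
    ℝ × ℝ → ℝ :=
  E.indicator fun p => ∏ i, |f i p| ^ (γ i)

/-- A boundary curve for the region `E`: one half of a graph `y = h(|x|^{1/N})` or
`x = h(|y|^{1/N})` with `h` real analytic, `h 0 = 0`, joining the origin to the circle
of radius `r₀`. -/
def IsPuiseuxBdryCurve (r₀ : ℝ) (C : Set (ℝ × ℝ)) : Prop :=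
  ∃ (N : ℕ) (h : ℝ → ℝ) (I : Set ℝ) (σ : ℝ),
    0 < N ∧ (σ = 1 ∨ σ = -1) ∧ IsOpen I ∧ Icc (0:ℝ) (r₀ ^ ((N:ℝ)⁻¹)) ⊆ I ∧
    AnalyticOnNhd ℝ h I ∧ h 0 = 0 ∧
    (C = {p : ℝ × ℝ | p ∈ closedDisk2 r₀ ∧ 0 ≤ σ * p.1 ∧
            p.2 = h (|p.1| ^ ((N:ℝ)⁻¹))} ∨
     C = {p : ℝ × ℝ | p ∈ closedDisk2 r₀ ∧ 0 ≤ σ * p.2 ∧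
            p.1 = h (|p.2| ^ ((N:ℝ)⁻¹))}) ∧
    (0:ℝ×ℝ) ∈ C ∧ ∃ p ∈ C, nrm2 p = r₀

/-- The admissible form of the set `E`: either a disk centered at the origin, or a finite
disjoint union of open regions, each bounded by two Puiseux boundary curves joining the
origin to the circle of radius `r₀` together with an arc of that circle, where all the
boundary curves are pairwise disjoint in the closed disk minus the origin. -/
def IsStdDomain (E : Set (ℝ × ℝ)) : Prop :=
  (∃ r₀ > (0:ℝ), E = disk2 r₀) ∨
  (∃ r₀ > (0:ℝ), ∃ m : ℕ, ∃ Es : Fin m → Set (ℝ × ℝ), ∃ Cs : Fin m → Fin 2 → Set (ℝ × ℝ),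
    E = Set.iUnion Es ∧
    (Pairwise fun i j => Disjoint (Es i) (Es j)) ∧
    (∀ i, IsOpen (Es i) ∧ Es i ⊆ disk2 r₀ ∧ (0:ℝ×ℝ) ∈ closure (Es i) ∧
      frontier (Es i) ⊆ Cs i 0 ∪ Cs i 1 ∪ circle2 r₀) ∧
    (∀ i j, IsPuiseuxBdryCurve r₀ (Cs i j)) ∧
    (Pairwise fun (q q' : Fin m × Fin 2) =>
      Disjoint (Cs q.1 q.2 ∩ (closedDisk2 r₀ \ {0}))
               (Cs q'.1 q'.2 ∩ (closedDisk2 r₀ \ {0}))))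

/-- The standard form of the paper: the `fᵢ` are real analytic and not identically zero
near the origin, `g = χ_E ∏ |fᵢ|^(γᵢ)` is integrable near the origin, and `E` is an
admissible domain. -/
structure StandardForm (n : ℕ) (f : Fin n → ℝ × ℝ → ℝ) (γ : Fin n → ℝ)
    (E : Set (ℝ × ℝ)) : Prop where
  analytic : ∃ U ∈ 𝓝 (0 : ℝ × ℝ), ∀ i, AnalyticOnNhd ℝ (f i) U
  nontriv : ∀ i, ¬ (∀ᶠ p in 𝓝 (0 : ℝ × ℝ), f i p = 0)
  integ : ∃ U ∈ 𝓝 (0 : ℝ × ℝ), IntegrableOn (stdFun n f γ E) U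
  domain : IsStdDomain E

/-- The two-sided bound `c₁ rᵉ |log r|^d ≤ ∫_{x²+y²<r²} g ≤ c₂ rᵉ |log r|^d` for all small
`r` ("ball exponents" `ε`, `d` of `g`, as in Lemma 1.1). -/
def BallBound (g : ℝ × ℝ → ℝ) (ε : ℝ) (d : ℕ) : Prop :=
  0 < ε ∧ d ≤ 1 ∧ ∃ c₁ > (0:ℝ), ∃ c₂ > (0:ℝ), ∃ c₃ > (0:ℝ), ∀ r : ℝ, 0 < r → r < c₃ →
    c₁ * r ^ ε * |Real.log r| ^ d ≤ (∫ p in disk2 r, g p) ∧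
    (∫ p in disk2 r, g p) ≤ c₂ * r ^ ε * |Real.log r| ^ d

/-- The strip `{(x,y) : |(x,y)·v| < r, |(x,y)·v^⊥| < c}`. -/
def strip2 (v : ℝ × ℝ) (r c : ℝ) : Set (ℝ × ℝ) :=
  {p : ℝ × ℝ | |dot2 p v| < r ∧ |dot2 p (perp2 v)| < c}

/-- The two-sided bound `a r^δ |log r|^e ≤ ∫_{strip} g ≤ b r^δ |log r|^e` for all small `r`,
for every small `c` ("strip exponents" `δ_v`, `e_v` of `g` in the direction `v`, as in
Lemma 1.2). -/
def StripBound (g : ℝ × ℝ → ℝ) (v : ℝ × ℝ) (δ : ℝ) (e : ℕ) : Prop :=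
  0 < δ ∧ e ≤ 1 ∧ ∃ cv > (0:ℝ), ∀ c : ℝ, 0 < c → c < cv →
    ∃ a > (0:ℝ), ∃ b > (0:ℝ), ∀ r : ℝ, 0 < r → r < c →
      a * r ^ δ * |Real.log r| ^ e ≤ (∫ p in strip2 v r c, g p) ∧
      (∫ p in strip2 v r c, g p) ≤ b * r ^ δ * |Real.log r| ^ e

/-- The order of vanishing of `f` at the origin. -/
def vanishingOrder (f : ℝ × ℝ → ℝ) : ℕ :=
  sInf {k : ℕ | iteratedFDeriv ℝ k f 0 ≠ 0}

/-- (A constant multiple of) the sum of the terms of lowest total degree in the Taylor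
expansion of `f` at the origin, as a homogeneous function on `ℝ²`. -/
def lowestPart (f : ℝ × ℝ → ℝ) (p : ℝ × ℝ) : ℝ :=
  iteratedFDeriv ℝ (vanishingOrder f) f 0 (fun _ => p)

/-- `w` is a tangent direction of the set `C` at the origin. -/
def IsTangentDirAt (C : Set (ℝ × ℝ)) (w : ℝ × ℝ) : Prop :=
  ∃ p : ℕ → ℝ × ℝ, (∀ k, p k ∈ C ∧ p k ≠ 0) ∧
    Tendsto p atTop (𝓝 (0:ℝ×ℝ)) ∧
    (Tendsto (fun k => (nrm2 (p k))⁻¹ • p k) atTop (𝓝 w) ∨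
     Tendsto (fun k => (nrm2 (p k))⁻¹ • p k) atTop (𝓝 (-w)))

/-- `w` is the direction of one of the lines `l₁, …, l_p`: a line through the origin in the
zero set of the lowest-degree Taylor part of some `fᵢ`, or a tangent line at the origin to
one of the boundary curves of `E`. -/
def ExceptionalDir (n : ℕ) (f : Fin n → ℝ × ℝ → ℝ) (E : Set (ℝ × ℝ)) (w : ℝ × ℝ) : Prop :=
  (∃ i, lowestPart (f i) w = 0) ∨ IsTangentDirAt (frontier E) w

/-- Conditions (1.2)-(1.3) on the factor `α`: `C¹` away from the origin, bounded by `A`,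
with gradient bounded by `A (x²+y²)^{-1/2}`. -/
def AlphaBound (α : ℝ × ℝ → ℝ) (A : ℝ) : Prop :=
  ContDiffOn ℝ 1 α {(0:ℝ×ℝ)}ᶜ ∧ (∀ p, |α p| ≤ A) ∧
  ∀ p : ℝ × ℝ, p ≠ 0 → ‖fderiv ℝ α p‖ ≤ A * (nrm2 p)⁻¹

/-- A smooth bump function equal to `1` near `(x₀, y₀)`, supported within (Euclidean)
distance `r` of `(x₀, y₀)`. -/
def IsBump (φ : ℝ × ℝ → ℝ) (x₀ y₀ : ℝ) (r : ℝ) : Prop :=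
  ContDiff ℝ (⊤ : ℕ∞) φ ∧ HasCompactSupport φ ∧ (∀ᶠ p in 𝓝 ((x₀, y₀) : ℝ × ℝ), φ p = 1) ∧
    tsupport φ ⊆ {p : ℝ × ℝ | (p.1 - x₀) ^ 2 + (p.2 - y₀) ^ 2 < r ^ 2}

/-- The oscillatory integral `∫_S h(x,y) e^{i(tx+uy)} dx dy`. -/
def oscInt (h : ℝ × ℝ → ℝ) (S : Set (ℝ × ℝ)) (t u : ℝ) : ℂ :=
  ∫ p in S, (h p : ℂ) * Complex.exp (Complex.I * ((t : ℂ) * (p.1 : ℂ) + (u : ℂ) * (p.2 : ℂ)))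

/-- The convolution kernel `K(t,u) = ∫ m(x,y) e^{i(tx+uy)} dx dy`. -/
def Kfull (m : ℝ × ℝ → ℝ) (t u : ℝ) : ℂ :=
  oscInt m Set.univ t u

/-- The localized kernel `K_φ(t,u) = ∫ φ(x,y) m(x,y) e^{i(tx+uy)} dx dy`. -/
def Kphi (φ m : ℝ × ℝ → ℝ) (t u : ℝ) : ℂ :=
  oscInt (fun p => φ p * m p) Set.univ t u

/-- `k` is a Puiseux function of index `N` on `[0,a]`: `k(x) = k'(x^{1/N})` for a function
`k'` real analytic on an open set containing `[0, a^{1/N}]`; equivalently `x ↦ k(x^N)` is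
real analytic. -/
def PuiseuxOn (N : ℕ) (a : ℝ) (k : ℝ → ℝ) : Prop :=
  ∃ (k' : ℝ → ℝ) (I : Set ℝ), IsOpen I ∧ Icc (0:ℝ) (a ^ ((N:ℝ)⁻¹)) ⊆ I ∧
    AnalyticOnNhd ℝ k' I ∧ ∀ x ∈ Icc (0:ℝ) a, k x = k' (x ^ ((N:ℝ)⁻¹))

/-- `k(x) = l·x^s + higher order terms` as `x → 0⁺`. -/
def LeadingTerm (k : ℝ → ℝ) (l s : ℝ) : Prop :=
  Tendsto (fun x => k x / x ^ s) (𝓝[>] (0:ℝ)) (𝓝 l)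

/-- The mixed partial derivative `∂_x^l ∂_y^m F`. -/
def pderiv2 (l m : ℕ) (F : ℝ × ℝ → ℝ) (p : ℝ × ℝ) : ℝ :=
  iteratedDeriv l (fun x => iteratedDeriv m (fun y => F (x, y)) p.2) p.1

/-- The descending product `α(α−1)⋯(α−l+1)`. -/
def descProd (α : ℝ) (l : ℕ) : ℝ := ∏ j ∈ Finset.range l, (α - (j : ℝ))

/-- The sliver `{(x,y) : 0 < x < a, g(x) < y < G(x)}`. -/
def sliverSet (a : ℝ) (g G : ℝ → ℝ) : Set (ℝ × ℝ) :=
  {q : ℝ × ℝ | 0 < q.1 ∧ q.1 < a ∧ g q.1 < q.2 ∧ q.2 < G q.1}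

/-- A wedge of radius `r₀` at the origin: a region bounded by two lines through the origin
and the circle of radius `r₀`. -/
def IsWedge (r₀ : ℝ) (W : Set (ℝ × ℝ)) : Prop :=
  ∃ θ₁ θ₂ : ℝ, θ₁ < θ₂ ∧ θ₂ ≤ θ₁ + 2 * π ∧
    W = {p : ℝ × ℝ | ∃ ρ θ : ℝ, 0 < ρ ∧ ρ < r₀ ∧ θ₁ < θ ∧ θ < θ₂ ∧
      p = (ρ * Real.cos θ, ρ * Real.sin θ)}


/-- The part of a nonnegative function lying above the level `c`. -/
def excess {X : Type*} (c : ℝ) (G : X → ℝ) (x : X) : ℝ≥0∞ :=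
  {x | c < G x}.indicator (fun x => ENNReal.ofReal (G x)) x

theorem ofReal_le_add_excess {X : Type*} (c : ℝ) (G : X → ℝ) (x : X) :
    ENNReal.ofReal (G x) ≤ ENNReal.ofReal c + excess c G x := by
  by_cases h : c < G x
  · simp [excess, h]
  · exact le_add_right (ENNReal.ofReal_le_ofReal (not_lt.1 h))

theorem measurable_excess {X : Type*} [MeasurableSpace X] {G : X → ℝ} (hG : Measurable G)
    (c : ℝ) : Measurable (excess c G) :=
  hG.ennreal_ofReal.indicator (measurableSet_lt measurable_const hG)

theorem setLIntegral_le_excess {X : Type*} [MeasurableSpace X] {μ : Measure X} (G : X → ℝ)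
    (c : ℝ) (s : Set X) :
    ∫⁻ x in s, ENNReal.ofReal (G x) ∂μ ≤ ENNReal.ofReal c * μ s + ∫⁻ x, excess c G x ∂μ := by
  calc ∫⁻ x in s, ENNReal.ofReal (G x) ∂μ
      ≤ ∫⁻ x in s, (ENNReal.ofReal c + excess c G x) ∂μ :=
        lintegral_mono fun x => ofReal_le_add_excess c G x
    _ = ENNReal.ofReal c * μ s + ∫⁻ x in s, excess c G x ∂μ := by
        rw [lintegral_add_left measurable_const, setLIntegral_const]
    _ ≤ _ := by gcongr; exact Measure.restrict_le_self

theorem setLIntegral_biUnion_finset_le {X ι : Type*} [MeasurableSpace X] {μ : Measure X}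
    (W : Finset ι) (A : ι → Set X) (F : X → ℝ≥0∞) :
    ∫⁻ x in ⋃ z ∈ W, A z, F x ∂μ ≤ ∑ z ∈ W, ∫⁻ x in A z, F x ∂μ := by
  classical
  induction W using Finset.induction_on with
  | empty => simp
  | insert a W ha ih =>
    rw [Finset.set_biUnion_insert, Finset.sum_insert ha]
    exact (lintegral_union_le _ _ _).trans (by gcongr)

theorem setLIntegral_Ioo_comp_add (F : ℝ → ℝ≥0∞) (a b δ : ℝ) :
    ∫⁻ x in Ioo a (b - δ), F (x + δ) = ∫⁻ x in Ioo (a + δ) b, F x := by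
  rw [← lintegral_indicator measurableSet_Ioo, ← lintegral_indicator measurableSet_Ioo,
    ← lintegral_add_right_eq_self ((Ioo (a + δ) b).indicator _) δ]
  congr 1; ext x
  simp only [indicator, mem_Ioo, add_lt_add_iff_right, lt_sub_iff_add_lt]

/-- The shift of a function that is monotone on an interval differs from it in `L¹` by at most the
mass near the end points. -/
theorem lintegral_shift_sub_le_of_monotoneOn {G : ℝ → ℝ} (hG : Measurable G) (h0 : ∀ x, 0 ≤ G x)
    {a b δ : ℝ} (hδ : 0 ≤ δ) (hm : MonotoneOn G (Ioo a b) ∨ AntitoneOn G (Ioo a b))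
    (hfin : ∫⁻ x in Ioo a b, ENNReal.ofReal (G x) ≠ ⊤) :
    ∫⁻ x in Ioo a (b - δ), ‖G (x + δ) - G x‖ₑ ≤
      ∫⁻ x in Icc a (a + δ) ∪ Icc (b - δ) b, ENNReal.ofReal (G x) := by
  have hGm := hG.ennreal_ofReal
  have hGs : Measurable fun x => ENNReal.ofReal (G (x + δ)) :=
    (hG.comp (measurable_id.add_const δ)).ennreal_ofReal
  have hmono : ∀ {s t : Set ℝ}, s ⊆ t → ∫⁻ x in s, ENNReal.ofReal (G x) ≤
      ∫⁻ x in t, ENNReal.ofReal (G x) := fun h => lintegral_mono_set h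
  have key : ∀ {x y : ℝ}, x ≤ y → 0 ≤ x → ‖y - x‖ₑ + ENNReal.ofReal x = ENNReal.ofReal y := by
    intro x y hxy hx
    rw [Real.enorm_of_nonneg (sub_nonneg.2 hxy), ← ENNReal.ofReal_add (sub_nonneg.2 hxy) hx]
    congr 1; ring
  rcases hm with hm | hm
  · have e : ∫⁻ x in Ioo a (b - δ), ‖G (x + δ) - G x‖ₑ + ENNReal.ofReal (G x) =
        ∫⁻ x in Ioo a (b - δ), ENNReal.ofReal (G (x + δ)) := by
      refine setLIntegral_congr_fun measurableSet_Ioo fun x hx => key (hm ?_ ?_ ?_) (h0 x)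
      · exact ⟨hx.1, by linarith [hx.2]⟩
      · exact ⟨by linarith [hx.1], by linarith [hx.2]⟩
      · linarith
    rw [lintegral_add_right _ hGm,
      setLIntegral_Ioo_comp_add (fun x => ENNReal.ofReal (G x))] at e
    refine (ENNReal.add_le_add_iff_right
      (ne_top_of_le_ne_top hfin (hmono (s := Ioo a (b - δ)) ?_))).1 ?_
    · exact Ioo_subset_Ioo_right (by linarith)
    rw [e, add_comm (lintegral _ _)]
    refine (hmono ?_).trans (lintegral_union_le _ _ _)
    intro x hx
    by_cases h : x < b - δ
    · exact Or.inl ⟨by linarith [hx.1], h⟩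
    · exact Or.inr (Or.inr ⟨not_lt.1 h, hx.2.le⟩)
  · have e : ∫⁻ x in Ioo a (b - δ), ‖G (x + δ) - G x‖ₑ + ENNReal.ofReal (G (x + δ)) =
        ∫⁻ x in Ioo a (b - δ), ENNReal.ofReal (G x) := by
      refine setLIntegral_congr_fun measurableSet_Ioo fun x hx => ?_
      rw [← enorm_neg, neg_sub]
      refine key (hm ?_ ?_ ?_) (h0 _)
      · exact ⟨hx.1, by linarith [hx.2]⟩
      · exact ⟨by linarith [hx.1], by linarith [hx.2]⟩
      · linarith
    rw [lintegral_add_right _ hGs,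
      setLIntegral_Ioo_comp_add (fun x => ENNReal.ofReal (G x))] at e
    refine (ENNReal.add_le_add_iff_right
      (ne_top_of_le_ne_top hfin (hmono (s := Ioo (a + δ) b) ?_))).1 ?_
    · exact Ioo_subset_Ioo_left (by linarith)
    rw [e, add_comm (lintegral _ _)]
    refine (hmono ?_).trans (lintegral_union_le _ _ _)
    intro x hx
    by_cases h : a + δ < x
    · exact Or.inl ⟨h, by linarith [hx.2]⟩
    · exact Or.inr (Or.inl ⟨hx.1.le, not_lt.1 h⟩)

/-- The shift of a function that is monotone off finitely many points differs from it in `L¹` by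
at most a multiple of `c δ` plus the mass of the function above the level `c`. -/
theorem lintegral_shift_sub_le_of_piecewise {G : ℝ → ℝ} (hG : Measurable G) (h0 : ∀ x, 0 ≤ G x)
    {r δ c : ℝ} (hδ : 0 ≤ δ) (hc : 0 ≤ c) (Z : Finset ℝ)
    (hZ : ∀ a b, Ioo a b ⊆ Ioo (-r) r → (∀ z ∈ Z, z ∉ Ioo a b) →
      MonotoneOn G (Ioo a b) ∨ AntitoneOn G (Ioo a b)) :
    ∫⁻ x in {x | x ∈ Ioo (-r) r ∧ x + δ ∈ Ioo (-r) r}, ‖G (x + δ) - G x‖ₑ ≤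
      (Z.card + 2 : ℕ) * (4 * (ENNReal.ofReal (c * δ) + ∫⁻ x, excess c G x)) := by
  classical
  set T := ∫⁻ x, excess c G x with hT
  set W : Finset ℝ := insert (-r) (insert r Z) with hW
  have hrW : r ∈ W := by simp [hW]
  have hrW' : -r ∈ W := by simp [hW]
  have hZW : ∀ z ∈ Z, z ∈ W := fun z hz => by simp [hW, hz]
  have hWcard : W.card ≤ Z.card + 2 :=
    (Finset.card_insert_le _ _).trans (Nat.succ_le_succ (Finset.card_insert_le _ _))
  by_cases hTt : T = ⊤
  · have : ((Z.card + 2 : ℕ) : ℝ≥0∞) * (4 * (ENNReal.ofReal (c * δ) + T)) = ⊤ := by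
      simp [hTt, ENNReal.mul_top]
    rw [this]; exact le_top
  have hbox : ∀ a b : ℝ, ∫⁻ x in Icc a b, ENNReal.ofReal (G x) ≤ ENNReal.ofReal (c * (b - a)) + T := by
    intro a b
    refine (setLIntegral_le_excess G c _).trans_eq ?_
    rw [Real.volume_Icc, ENNReal.ofReal_mul hc]
  let A : ℝ → Set ℝ := fun z =>
    {x | x ∈ Ioo (-r) r ∧ x + δ ∈ Ioo (-r) r ∧ z < x ∧ ∀ z' ∈ W, z < z' → x + δ < z'}
  have hA : ∀ z ∈ W, ∫⁻ x in A z, ‖G (x + δ) - G x‖ₑ ≤ 2 * (ENNReal.ofReal (c * δ) + T) := by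
    intro z hz
    rcases (A z).eq_empty_or_nonempty with h | ⟨x₀, hx₀, hx₀', hzx, hx₀W⟩
    · simp [h]
    have hne : (W.filter (z < ·)).Nonempty := ⟨r, by simp [hrW]; exact hzx.trans hx₀.2⟩
    set b := (W.filter (z < ·)).min' hne with hb
    have hbm : b ∈ W ∧ z < b := Finset.mem_filter.1 (Finset.min'_mem _ hne)
    have hbmin : ∀ z' ∈ W, z < z' → b ≤ z' := fun z' h1 h2 =>
      Finset.min'_le _ _ (by simp [h1, h2])
    have hzr : -r ≤ z := by
      by_contra! h
      have := hx₀W _ hrW' h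
      linarith [hx₀'.1]
    have hbr : b ≤ r := hbmin r hrW (hzx.trans hx₀.2)
    have hsub : A z ⊆ Ioo z (b - δ) := fun x hx =>
      ⟨hx.2.2.1, by linarith [hx.2.2.2 b hbm.1 hbm.2]⟩
    refine (lintegral_mono_set hsub).trans ?_
    refine (lintegral_shift_sub_le_of_monotoneOn hG h0 hδ (hZ z b ?_ ?_) ?_).trans ?_
    · exact Ioo_subset_Ioo hzr hbr
    · exact fun w hw hw' => absurd hw'.2 (not_lt.2 (hbmin w (hZW w hw) hw'.1))
    · refine ne_top_of_le_ne_top ?_ ((lintegral_mono_set Ioo_subset_Icc_self).trans (hbox z b))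
      simp [hTt]
    · refine (lintegral_union_le _ _ _).trans ?_
      rw [two_mul]
      refine add_le_add ((hbox _ _).trans_eq ?_) ((hbox _ _).trans_eq ?_) <;> congr 3 <;> ring
  have hB : ∀ z ∈ W, ∫⁻ x in Icc (z - δ) z, ‖G (x + δ) - G x‖ₑ ≤
      2 * (ENNReal.ofReal (c * δ) + T) := by
    intro z _
    have hGs : Measurable fun x => ENNReal.ofReal (G (x + δ)) :=
      (hG.comp (measurable_id.add_const δ)).ennreal_ofReal
    have hshift : ∫⁻ x in Icc (z - δ) z, ENNReal.ofReal (G (x + δ)) =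
        ∫⁻ x in Icc z (z + δ), ENNReal.ofReal (G x) := by
      rw [← lintegral_indicator measurableSet_Icc, ← lintegral_indicator measurableSet_Icc,
        ← lintegral_add_right_eq_self ((Icc z (z + δ)).indicator _) δ]
      congr 1; ext x
      simp only [indicator, mem_Icc, add_le_add_iff_right, sub_le_iff_le_add]
    calc ∫⁻ x in Icc (z - δ) z, ‖G (x + δ) - G x‖ₑ
        ≤ ∫⁻ x in Icc (z - δ) z, (ENNReal.ofReal (G (x + δ)) + ENNReal.ofReal (G x)) := by
          refine lintegral_mono fun x => ?_
          rw [← Real.enorm_of_nonneg (h0 _), ← Real.enorm_of_nonneg (h0 x)]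
          exact enorm_sub_le
      _ ≤ _ := by
          rw [lintegral_add_left hGs, hshift, two_mul]
          refine add_le_add ((hbox _ _).trans_eq ?_) ((hbox _ _).trans_eq ?_) <;> congr 3 <;> ring
  have hcover : {x | x ∈ Ioo (-r) r ∧ x + δ ∈ Ioo (-r) r} ⊆ ⋃ z ∈ W, (A z ∪ Icc (z - δ) z) := by
    rintro x ⟨hx, hx'⟩
    simp only [mem_iUnion]
    by_cases h : ∃ z ∈ W, x ≤ z ∧ z ≤ x + δ
    · obtain ⟨z, hz, h1, h2⟩ := h
      exact ⟨z, hz, Or.inr ⟨by linarith, h1⟩⟩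
    push Not at h
    have hne : (W.filter (· < x)).Nonempty := ⟨-r, by simp [hrW', hx.1]⟩
    have hm : (W.filter (· < x)).max' hne ∈ W ∧ (W.filter (· < x)).max' hne < x := 
      Finset.mem_filter.1 (Finset.max'_mem _ hne)
    refine ⟨_, hm.1, Or.inl ⟨hx, hx', hm.2, fun z' hz' hlt => ?_⟩⟩
    refine h z' hz' (not_lt.1 fun hlt' => ?_)
    exact absurd (Finset.le_max' (W.filter (· < x)) z' (by simp [hz', hlt'])) (not_le.2 hlt)
  calc ∫⁻ x in {x | x ∈ Ioo (-r) r ∧ x + δ ∈ Ioo (-r) r}, ‖G (x + δ) - G x‖ₑ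
      ≤ ∫⁻ x in ⋃ z ∈ W, (A z ∪ Icc (z - δ) z), ‖G (x + δ) - G x‖ₑ := lintegral_mono_set hcover
    _ ≤ ∑ z ∈ W, ∫⁻ x in A z ∪ Icc (z - δ) z, ‖G (x + δ) - G x‖ₑ :=
        setLIntegral_biUnion_finset_le _ _ _
    _ ≤ ∑ z ∈ W, 4 * (ENNReal.ofReal (c * δ) + T) := by
        refine Finset.sum_le_sum fun z hz => (lintegral_union_le _ _ _).trans ?_
        refine (add_le_add (hA z hz) (hB z hz)).trans_eq ?_
        ring
    _ ≤ _ := by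
        rw [Finset.sum_const, nsmul_eq_mul]
        gcongr

/-- The derivative of `G` in the direction `v`. -/
def dirDeriv (v : ℝ × ℝ) (G : ℝ × ℝ → ℝ) (p : ℝ × ℝ) : ℝ := fderiv ℝ G p v

theorem AnalyticOnNhd.dirDeriv {G : ℝ × ℝ → ℝ} {U : Set (ℝ × ℝ)} (hG : AnalyticOnNhd ℝ G U)
    (v : ℝ × ℝ) : AnalyticOnNhd ℝ (dirDeriv v G) U :=
  fun p hp => ((ContinuousLinearMap.apply ℝ ℝ v).analyticAt _).comp (hG.fderiv p hp)

theorem AnalyticOnNhd.iterate_dirDeriv {G : ℝ × ℝ → ℝ} {U : Set (ℝ × ℝ)}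
    (hG : AnalyticOnNhd ℝ G U) (v : ℝ × ℝ) (k : ℕ) :
    AnalyticOnNhd ℝ ((_root_.dirDeriv v)^[k] G) U := by
  induction k with
  | zero => exact hG
  | succ k ih => rw [Function.iterate_succ_apply']; exact ih.dirDeriv v

theorem eqOn_dirDeriv {F G : ℝ × ℝ → ℝ} {U : Set (ℝ × ℝ)} (hU : IsOpen U) (h : EqOn F G U)
    (v : ℝ × ℝ) : EqOn (dirDeriv v F) (dirDeriv v G) U := by
  intro p hp
  simp only [dirDeriv]
  rw [(h.eventuallyEq_of_mem (hU.mem_nhds hp)).fderiv_eq]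

theorem dirDeriv_comm {G : ℝ × ℝ → ℝ} {U : Set (ℝ × ℝ)} (hG : AnalyticOnNhd ℝ G U)
    (v w : ℝ × ℝ) : EqOn (dirDeriv v (dirDeriv w G)) (dirDeriv w (dirDeriv v G)) U := by
  intro p hp
  have hd : DifferentiableAt ℝ (fderiv ℝ G) p := (hG.fderiv p hp).differentiableAt
  have h : ∀ a b : ℝ × ℝ, dirDeriv a (dirDeriv b G) p = fderiv ℝ (fderiv ℝ G) p a b := by
    intro a b
    have : HasFDerivAt (dirDeriv b G) ((fderiv ℝ (fderiv ℝ G) p).flip b) p := by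
      have h := hd.hasFDerivAt.clm_apply (hasFDerivAt_const b p)
      rw [ContinuousLinearMap.comp_zero, zero_add] at h
      exact h
    rw [dirDeriv, this.fderiv]; rfl
  rw [h, h]
  exact (hG p hp).contDiffAt.isSymmSndFDerivAt (n := ⊤) (by simp) v w

theorem iterate_dirDeriv_comm {G : ℝ × ℝ → ℝ} {U : Set (ℝ × ℝ)} (hU : IsOpen U)
    (hG : AnalyticOnNhd ℝ G U) (v w : ℝ × ℝ) (k n : ℕ) :
    EqOn ((dirDeriv v)^[k] ((dirDeriv w)^[n] G)) ((dirDeriv w)^[n] ((dirDeriv v)^[k] G)) U := by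
  have one : ∀ {F : ℝ × ℝ → ℝ}, AnalyticOnNhd ℝ F U →
      EqOn (dirDeriv v ((dirDeriv w)^[n] F)) ((dirDeriv w)^[n] (dirDeriv v F)) U := by
    intro F hF
    induction n with
    | zero => exact fun _ _ => rfl
    | succ n ih =>
      simp only [Function.iterate_succ_apply']
      exact (dirDeriv_comm (hF.iterate_dirDeriv w n) v w).trans (eqOn_dirDeriv hU ih w)
  induction k with
  | zero => exact fun _ _ => rfl
  | succ k ih =>
    simp only [Function.iterate_succ_apply']
    exact (eqOn_dirDeriv hU ih v).trans (one (hG.iterate_dirDeriv v k))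

theorem hasDerivAt_slice_fst {F : ℝ × ℝ → ℝ} {x y : ℝ} (hF : DifferentiableAt ℝ F (x, y)) :
    HasDerivAt (fun s => F (s, y)) (dirDeriv (1, 0) F (x, y)) x :=
  hF.hasFDerivAt.comp_hasDerivAt x ((hasDerivAt_id x).prodMk (hasDerivAt_const x y))

theorem hasDerivAt_slice_snd {F : ℝ × ℝ → ℝ} {x y : ℝ} (hF : DifferentiableAt ℝ F (x, y)) :
    HasDerivAt (fun s => F (x, s)) (dirDeriv (0, 1) F (x, y)) y :=
  hF.hasFDerivAt.comp_hasDerivAt y ((hasDerivAt_const y x).prodMk (hasDerivAt_id y))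

theorem eqOn_zero_of_derivs_eq_zero {r : ℝ} (hr : 0 < r) {ψ : ℕ → ℝ → ℝ}
    (han : AnalyticOnNhd ℝ (ψ 0) (Ioo (-r) r))
    (hψ : ∀ j, ∀ x ∈ Ioo (-r) r, HasDerivAt (ψ j) (ψ (j + 1) x) x) (h0 : ∀ j, ψ j 0 = 0) :
    EqOn (ψ 0) 0 (Ioo (-r) r) := by
  have hmem : (0 : ℝ) ∈ Ioo (-r) r := ⟨by linarith, hr⟩
  have hit : ∀ j, EqOn (iteratedDeriv j (ψ 0)) (ψ j) (Ioo (-r) r) := by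
    intro j
    induction j with
    | zero => intro x _; simp
    | succ j ih =>
      intro x hx
      rw [iteratedDeriv_succ, (ih.eventuallyEq_of_mem (isOpen_Ioo.mem_nhds hx)).deriv_eq]
      exact (hψ j x hx).deriv
  refine han.eqOn_zero_of_preconnected_of_eventuallyEq_zero isPreconnected_Ioo hmem ?_
  rw [EventuallyEq]
  refine analyticOrderAt_eq_top.1 (ENat.eq_top_iff_forall_ge.2 fun n => ?_)
  exact (natCast_le_analyticOrderAt_iff_iteratedDeriv_eq_zero (han 0 hmem)).2
    fun i _ => (hit i hmem).trans (h0 i)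

theorem ne_zero_of_deriv_ne_zero {r : ℝ} (k : ℕ) {ψ : ℕ → ℝ → ℝ}
    (hψ : ∀ j, ∀ x ∈ Ioo (-r) r, HasDerivAt (ψ j) (ψ (j + 1) x) x) (h0 : ∀ j < k, ψ j 0 = 0)
    (hk : ∀ x ∈ Ioo (-r) r, ψ k x ≠ 0) : ∀ x ∈ Ioo (-r) r, x ≠ 0 → ψ 0 x ≠ 0 := by
  induction k generalizing ψ with
  | zero => exact fun x hx _ => hk x hx
  | succ k ih =>
    intro x hx hx0 hzero
    have h1 := ih (ψ := fun j => ψ (j + 1)) (fun j => hψ (j + 1))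
      (fun j hj => h0 (j + 1) (by omega)) hk
    have h00 : ψ 0 0 = 0 := h0 0 (by omega)
    have rolle : ∀ a b : ℝ, a < b → -r < a → b < r → ψ 0 a = ψ 0 b → 
        ∃ c ∈ Ioo a b, ψ 1 c = 0 := by
      intro a b hab ha hb he
      have hsub : ∀ s ∈ Icc a b, s ∈ Ioo (-r) r := fun s hs =>
        ⟨by linarith [hs.1], by linarith [hs.2]⟩
      exact exists_hasDerivAt_eq_zero hab
        (fun s hs => (hψ 0 s (hsub s hs)).continuousAt.continuousWithinAt) he
        fun s hs => hψ 0 s (hsub s (Ioo_subset_Icc_self hs))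
    rcases lt_or_gt_of_ne hx0 with h | h
    · obtain ⟨c, hc, hc0⟩ := rolle x 0 h hx.1 (by linarith [hx.1]) (by rw [hzero, h00])
      exact h1 c ⟨by linarith [hx.1, hc.1], by linarith [hx.1, hc.2]⟩ hc.2.ne hc0
    · obtain ⟨c, hc, hc0⟩ := rolle 0 x h (by linarith [hx.2]) hx.2 (by rw [hzero, h00])
      exact h1 c ⟨by linarith [hx.2, hc.1], by linarith [hx.2, hc.2]⟩ hc.1.ne' hc0

theorem exists_finset_zeros {r : ℝ} (k : ℕ) {ψ : ℕ → ℝ → ℝ}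
    (hψ : ∀ j, ∀ x ∈ Ioo (-r) r, HasDerivAt (ψ j) (ψ (j + 1) x) x)
    (hk : ∀ x ∈ Ioo (-r) r, ψ k x ≠ 0) :
    ∃ Z : Finset ℝ, Z.card ≤ k ∧ ∀ x ∈ Ioo (-r) r, ψ 0 x = 0 → x ∈ Z := by
  induction k generalizing ψ with
  | zero => exact ⟨∅, by simp, fun x hx h => absurd h (hk x hx)⟩
  | succ k ih =>
    obtain ⟨Z, hZ, hZ'⟩ := ih (ψ := fun j => ψ (j + 1)) (fun j => hψ (j + 1)) hk
    set S : Set ℝ := {x | x ∈ Ioo (-r) r ∧ ψ 0 x = 0} with hS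
    let cnt : ℝ → ℕ := fun x => (Z.filter (· < x)).card
    have hmaps : ∀ x ∈ S, cnt x ∈ (Finset.range (k + 1) : Set ℕ) := fun x _ => by
      have : cnt x ≤ Z.card := Finset.card_filter_le _ _
      simp; omega
    have hlt : ∀ x ∈ S, ∀ y ∈ S, x < y → cnt x < cnt y := by
      intro x hx y hy hxy
      have hsub : ∀ s ∈ Icc x y, s ∈ Ioo (-r) r := fun s hs =>
        ⟨by linarith [hs.1, hx.1.1], by linarith [hs.2, hy.1.2]⟩
      obtain ⟨c, hc, hc0⟩ := exists_hasDerivAt_eq_zero hxy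
        (fun s hs => (hψ 0 s (hsub s hs)).continuousAt.continuousWithinAt) (hx.2.trans hy.2.symm)
        fun s hs => hψ 0 s (hsub s (Ioo_subset_Icc_self hs))
      have hcZ := hZ' c (hsub c (Ioo_subset_Icc_self hc)) hc0
      refine Finset.card_lt_card (Finset.ssubset_iff_of_subset ?_ |>.2 ⟨c, ?_, ?_⟩)
      · intro s hs
        simp only [Finset.mem_filter] at hs ⊢
        exact ⟨hs.1, hs.2.trans hxy⟩
      · simp [hcZ, hc.2]
      · simp [hc.1.le]
    have hinj : InjOn cnt S := by
      intro x hx y hy he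
      by_contra hne
      rcases lt_or_gt_of_ne hne with h | h
      · exact (hlt x hx y hy h).ne he
      · exact (hlt y hy x hx h).ne' he
    have hfin : S.Finite := Set.Finite.of_injOn hmaps hinj (Finset.finite_toSet _)
    refine ⟨hfin.toFinset, ?_, fun x hx h => by simp [hS, h]; exact hx⟩
    have := Finset.card_le_card_of_injOn (s := hfin.toFinset) (t := Finset.range (k + 1)) cnt
      (fun x hx => by exact_mod_cast hmaps x (by simpa using hx)) (by simpa using hinj)
    simpa using this

/-- Near the origin, all horizontal lines other than the axis meet `S` in a bounded number of
points. -/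
def SliceFinite (S : Set (ℝ × ℝ)) : Prop :=
  ∃ r > (0 : ℝ), ∃ M : ℕ, ∀ y : ℝ, y ≠ 0 → |y| < r → ∃ Z : Finset ℝ, Z.card ≤ M ∧
    ∀ x : ℝ, |x| < r → (x, y) ∈ S → x ∈ Z

theorem mem_ball_zero_prod {r x y : ℝ} :
    (x, y) ∈ ball (0 : ℝ × ℝ) r ↔ |x| < r ∧ |y| < r := by
  simp [Prod.norm_def]

theorem sliceFinite_zeros {G : ℝ × ℝ → ℝ} (hG : AnalyticAt ℝ G 0)
    (hG0 : ¬ ∀ᶠ p in 𝓝 0, G p = 0) : SliceFinite {p | G p = 0} := by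
  obtain ⟨r, hr, hGr⟩ := Metric.eventually_nhds_iff_ball.1 hG.eventually_analyticAt
  set U := ball (0 : ℝ × ℝ) r with hU
  have hUo : IsOpen U := isOpen_ball
  have hGU : AnalyticOnNhd ℝ G U := hGr
  have hslx : ∀ {F : ℝ × ℝ → ℝ}, AnalyticOnNhd ℝ F U → ∀ y, |y| < r → ∀ j, ∀ x ∈ Ioo (-r) r,
      HasDerivAt (fun s => (dirDeriv (1, 0))^[j] F (s, y))
        ((dirDeriv (1, 0))^[j + 1] F (x, y)) x := by
    intro F hF y hy j x hx
    rw [Function.iterate_succ_apply']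
    exact hasDerivAt_slice_fst ((hF.iterate_dirDeriv _ j) (x, y)
      (mem_ball_zero_prod.2 ⟨abs_lt.2 hx, hy⟩)).differentiableAt
  have hsly : ∀ {F : ℝ × ℝ → ℝ}, AnalyticOnNhd ℝ F U → ∀ x, |x| < r → ∀ j, ∀ y ∈ Ioo (-r) r,
      HasDerivAt (fun s => (dirDeriv (0, 1))^[j] F (x, s))
        ((dirDeriv (0, 1))^[j + 1] F (x, y)) y := by
    intro F hF x hx j y hy
    rw [Function.iterate_succ_apply']
    exact hasDerivAt_slice_snd ((hF.iterate_dirDeriv _ j) (x, y)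
      (mem_ball_zero_prod.2 ⟨hx, abs_lt.2 hy⟩)).differentiableAt
  have hanx : ∀ {F : ℝ × ℝ → ℝ}, AnalyticOnNhd ℝ F U → ∀ y, |y| < r →
      AnalyticOnNhd ℝ (fun s => F (s, y)) (Ioo (-r) r) := fun hF y hy x hx =>
    (hF (x, y) (mem_ball_zero_prod.2 ⟨abs_lt.2 hx, hy⟩)).comp₂ analyticAt_id analyticAt_const
  have hany : ∀ {F : ℝ × ℝ → ℝ}, AnalyticOnNhd ℝ F U → ∀ x, |x| < r →
      AnalyticOnNhd ℝ (fun s => F (x, s)) (Ioo (-r) r) := fun hF x hx y hy =>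
    (hF (x, y) (mem_ball_zero_prod.2 ⟨hx, abs_lt.2 hy⟩)).comp₂ analyticAt_const analyticAt_id
  have hr0 : |(0 : ℝ)| < r := by simpa using hr
  have hex : ∃ k, ∃ x ∈ Ioo (-r) r, (dirDeriv (0, 1))^[k] G (x, 0) ≠ 0 := by
    by_contra! h
    refine hG0 (Metric.eventually_nhds_iff_ball.2 ⟨r, hr, ?_⟩)
    rintro ⟨x, y⟩ hxy
    obtain ⟨hx, hy⟩ := mem_ball_zero_prod.1 hxy
    exact eqOn_zero_of_derivs_eq_zero (ψ := fun j s => (dirDeriv (0, 1))^[j] G (x, s)) hr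
      (hany hGU x hx) (hsly hGU x hx) (fun j => h j x (abs_lt.1 hx)) (abs_lt.1 hy)
  classical
  set k := Nat.find hex with hk
  obtain ⟨x₁, hx₁, hkx₁⟩ := Nat.find_spec hex
  have hkmin : ∀ j < k, ∀ x ∈ Ioo (-r) r, (dirDeriv (0, 1))^[j] G (x, 0) = 0 := by
    intro j hj
    have := Nat.find_min hex hj
    push Not at this
    exact this
  have hGk : AnalyticOnNhd ℝ ((dirDeriv (0, 1))^[k] G) U := hGU.iterate_dirDeriv _ k
  obtain ⟨N, hN⟩ : ∃ N, (dirDeriv (1, 0))^[N] ((dirDeriv (0, 1))^[k] G) (0, 0) ≠ 0 := by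
    by_contra! h
    exact hkx₁ (eqOn_zero_of_derivs_eq_zero
      (ψ := fun j s => (dirDeriv (1, 0))^[j] ((dirDeriv (0, 1))^[k] G) (s, 0)) hr
      (hanx hGk 0 hr0) (hslx hGk 0 hr0) h hx₁)
  set H := (dirDeriv (1, 0))^[N] G with hH
  have hHU : AnalyticOnNhd ℝ H U := hGU.iterate_dirDeriv _ N
  have h0U : ((0 : ℝ), (0 : ℝ)) ∈ U := mem_ball_zero_prod.2 ⟨hr0, hr0⟩
  have hHk : (dirDeriv (0, 1))^[k] H (0, 0) ≠ 0 := by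
    rwa [hH, iterate_dirDeriv_comm hUo hGU _ _ k N h0U]
  have hHj : ∀ j < k, ∀ x ∈ Ioo (-r) r, (dirDeriv (0, 1))^[j] H (x, 0) = 0 := by
    intro j hj x hx
    rw [hH, iterate_dirDeriv_comm hUo hGU _ _ j N (mem_ball_zero_prod.2 ⟨abs_lt.2 hx, hr0⟩)]
    have : ∀ i, EqOn (fun s => (dirDeriv (1, 0))^[i] ((dirDeriv (0, 1))^[j] G) (s, 0)) 0
        (Ioo (-r) r) := by
      intro i
      induction i with
      | zero => exact fun x hx => hkmin j hj x hx
      | succ i ih =>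
        intro x hx
        have h1 := hslx (hGU.iterate_dirDeriv (0, 1) j) 0 hr0 i x hx
        have h2 := (ih.eventuallyEq_of_mem (isOpen_Ioo.mem_nhds hx)).deriv_eq
        rw [h1.deriv] at h2
        simpa using h2
    exact this N hx
  have hcont : ContinuousAt ((dirDeriv (0, 1))^[k] H) (0, 0) :=
    (hHU.iterate_dirDeriv _ k _ h0U).continuousAt
  obtain ⟨r', hr', hHr'⟩ := Metric.eventually_nhds_iff_ball.1 (hcont.eventually_ne hHk)
  set ρ := min r r' with hρ
  have hρ0 : 0 < ρ := lt_min hr hr'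
  have hsub : Ioo (-ρ) ρ ⊆ Ioo (-r) r :=
    Ioo_subset_Ioo (neg_le_neg (min_le_left _ _)) (min_le_left _ _)
  refine ⟨ρ, hρ0, N, fun y hy0 hy => ?_⟩
  obtain ⟨Z, hZc, hZ⟩ := exists_finset_zeros (r := ρ) N
    (ψ := fun j s => (dirDeriv (1, 0))^[j] G (s, y))
    (fun j x hx => hslx hGU y (hy.trans_le (min_le_left _ _)) j x (hsub hx)) (by
      intro x hx
      refine ne_zero_of_deriv_ne_zero (r := ρ) k
        (ψ := fun j s => (dirDeriv (0, 1))^[j] H (x, s))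
        (fun j s hs => hsly hHU x (abs_lt.2 (hsub hx)) j s (hsub hs))
        (fun j hj => hHj j hj x (hsub hx)) (fun s hs => hHr' _ ?_) y (abs_lt.1 hy) hy0
      exact mem_ball_zero_prod.2 ⟨(abs_lt.2 hx).trans_le (min_le_right _ _),
        (abs_lt.2 hs).trans_le (min_le_right _ _)⟩)
  exact ⟨Z, hZc, fun x hx hxy => hZ x (abs_lt.1 hx) hxy⟩

theorem SliceFinite.mono {S T : Set (ℝ × ℝ)} (hT : SliceFinite T)
    (h : ∀ᶠ p in 𝓝 (0 : ℝ × ℝ), p ∈ S → p ∈ T) : SliceFinite S := by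
  obtain ⟨r, hr, M, hM⟩ := hT
  obtain ⟨r', hr', h⟩ := Metric.eventually_nhds_iff_ball.1 h
  refine ⟨min r r', lt_min hr hr', M, fun y hy hyr => ?_⟩
  obtain ⟨hy1, hy2⟩ := lt_min_iff.1 hyr
  obtain ⟨Z, hZ, hZ'⟩ := hM y hy hy1
  refine ⟨Z, hZ, fun x hx hxS => ?_⟩
  obtain ⟨hx1, hx2⟩ := lt_min_iff.1 hx
  exact hZ' x hx1 (h _ (mem_ball_zero_prod.2 ⟨hx2, hy2⟩) hxS)

theorem SliceFinite.empty : SliceFinite ∅ :=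
  ⟨1, one_pos, 0, fun _ _ _ => ⟨∅, by simp, by simp⟩⟩

theorem SliceFinite.union {S T : Set (ℝ × ℝ)} (hS : SliceFinite S) (hT : SliceFinite T) :
    SliceFinite (S ∪ T) := by
  classical
  obtain ⟨r, hr, M, hM⟩ := hS
  obtain ⟨r', hr', M', hM'⟩ := hT
  refine ⟨min r r', lt_min hr hr', M + M', fun y hy hyr => ?_⟩
  obtain ⟨hy1, hy2⟩ := lt_min_iff.1 hyr
  obtain ⟨Z, hZ, hZS⟩ := hM y hy hy1
  obtain ⟨Z', hZ', hZT⟩ := hM' y hy hy2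
  refine ⟨Z ∪ Z', (Finset.card_union_le _ _).trans (by omega), fun x hx hxS => ?_⟩
  obtain ⟨hx1, hx2⟩ := lt_min_iff.1 hx
  exact Finset.mem_union.2 (hxS.imp (hZS x hx1) (hZT x hx2))

theorem SliceFinite.iUnion {ι : Type*} [Finite ι] {S : ι → Set (ℝ × ℝ)}
    (hS : ∀ i, SliceFinite (S i)) : SliceFinite (⋃ i, S i) := by
  classical
  have := Fintype.ofFinite ι
  have key : ∀ W : Finset ι, SliceFinite (⋃ i ∈ W, S i) := by
    intro W
    induction W using Finset.induction_on with
    | empty => simpa using SliceFinite.empty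
    | insert a W _ ih => rw [Finset.set_biUnion_insert]; exact (hS a).union ih
  simpa using key Finset.univ

theorem sliceFinite_graph_snd (h : ℝ → ℝ) (N : ℕ) :
    SliceFinite {p : ℝ × ℝ | p.1 = h (|p.2| ^ ((N : ℝ)⁻¹))} :=
  ⟨1, one_pos, 1, fun y _ _ => ⟨{h (|y| ^ ((N : ℝ)⁻¹))}, by simp, fun x _ hx => by simpa using hx⟩⟩

theorem sliceFinite_graph_fst {h : ℝ → ℝ} (hh : AnalyticAt ℝ h 0) {N : ℕ} (hN : 0 < N) {σ : ℝ}
    (hσ : σ = 1 ∨ σ = -1) :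
    SliceFinite {p : ℝ × ℝ | 0 ≤ σ * p.1 ∧ p.2 = h (|p.1| ^ ((N : ℝ)⁻¹))} := by
  classical
  have hG : AnalyticAt ℝ (fun p : ℝ × ℝ => h p.1 - p.2) 0 :=
    (AnalyticAt.comp (g := h) (f := Prod.fst) hh analyticAt_fst).sub analyticAt_snd
  have hG0 : ¬ ∀ᶠ p in 𝓝 (0 : ℝ × ℝ), h p.1 - p.2 = 0 := by
    intro hev
    obtain ⟨r, hr, hr'⟩ := Metric.eventually_nhds_iff_ball.1 hev
    have h1 := hr' (0, 0) (mem_ball_zero_prod.2 (by simpa using hr))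
    have h2 := hr' (0, r / 2) (mem_ball_zero_prod.2
      ⟨by simpa using hr, by rw [abs_of_pos (by linarith)]; linarith⟩)
    simp only at h1 h2
    linarith
  obtain ⟨r, hr, M, hM⟩ := sliceFinite_zeros hG hG0
  refine ⟨min r (r ^ N), lt_min hr (pow_pos hr N), M, fun y hy hyr => ?_⟩
  obtain ⟨Z, hZ, hZ'⟩ := hM y hy (hyr.trans_le (min_le_left _ _))
  refine ⟨Z.image fun s => σ * s ^ N, Finset.card_image_le.trans hZ, fun x hx hxS => ?_⟩
  have hpow : (|x| ^ ((N : ℝ)⁻¹)) ^ N = |x| := Real.rpow_inv_natCast_pow (abs_nonneg x) hN.ne'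
  have hnn : 0 ≤ |x| ^ ((N : ℝ)⁻¹) := Real.rpow_nonneg (abs_nonneg x) _
  refine Finset.mem_image.2 ⟨|x| ^ ((N : ℝ)⁻¹), hZ' _ ?_ ?_, ?_⟩
  · rw [abs_of_nonneg hnn]
    refine lt_of_pow_lt_pow_left₀ N hr.le ?_
    rw [hpow]
    exact hx.trans_le (min_le_right _ _)
  · simp only [mem_ofPred_eq] at hxS ⊢
    rw [← hxS.2, sub_self]
  · rw [hpow]
    have h1 : 0 ≤ σ * x := hxS.1
    rcases hσ with rfl | rfl
    · rw [one_mul, abs_of_nonneg (by linarith)]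
    · rw [abs_of_nonpos (by linarith)]; ring

theorem IsPuiseuxBdryCurve.sliceFinite {r₀ : ℝ} (hr₀ : 0 < r₀) {C : Set (ℝ × ℝ)}
    (hC : IsPuiseuxBdryCurve r₀ C) : SliceFinite C ∧ SliceFinite (Prod.swap ⁻¹' C) := by
  obtain ⟨N, h, I, σ, hN, hσ, -, hI, hh, -, hC, -⟩ := hC
  have h0 : AnalyticAt ℝ h 0 := hh 0 (hI ⟨le_rfl, Real.rpow_nonneg hr₀.le _⟩)
  have h1 := sliceFinite_graph_fst h0 hN hσ
  have h2 := sliceFinite_graph_snd h N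
  rcases hC with rfl | rfl
  · exact ⟨h1.mono (.of_forall fun p hp => hp.2), h2.mono (.of_forall fun p hp => hp.2.2)⟩
  · exact ⟨h2.mono (.of_forall fun p hp => hp.2.2), h1.mono (.of_forall fun p hp => hp.2)⟩

theorem frontier_iUnion_subset {X ι : Type*} [TopologicalSpace X] [Finite ι] (S : ι → Set X) :
    frontier (⋃ i, S i) ⊆ ⋃ i, frontier (S i) := by
  intro x hx
  rw [frontier, closure_iUnion_of_finite, Set.mem_sdiff, mem_iUnion] at hx
  obtain ⟨⟨i, hi⟩, hx⟩ := hx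
  exact mem_iUnion.2 ⟨i, hi, fun h => hx (interior_mono (subset_iUnion S i) h)⟩

theorem eventually_notMem_circle2 {r₀ : ℝ} (hr₀ : 0 < r₀) :
    ∀ᶠ p in 𝓝 (0 : ℝ × ℝ), p ∉ circle2 r₀ := by
  have hc : IsClosed (circle2 r₀) := isClosed_eq (by fun_prop) continuous_const
  exact hc.isOpen_compl.mem_nhds fun h => by
    have h : (0 : ℝ) ^ 2 + 0 ^ 2 = r₀ ^ 2 := h
    nlinarith [pow_pos hr₀ 2]

theorem isOpen_disk2 (r : ℝ) : IsOpen (disk2 r) := isOpen_lt (by fun_prop) continuous_const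

theorem frontier_disk2_subset (r : ℝ) : frontier (disk2 r) ⊆ circle2 r :=
  frontier_lt_subset_eq (by fun_prop) continuous_const

theorem IsStdDomain.isOpen {E : Set (ℝ × ℝ)} (hE : IsStdDomain E) : IsOpen E := by
  rcases hE with ⟨r₀, -, rfl⟩ | ⟨r₀, -, m, Es, Cs, rfl, -, h, -⟩
  · exact isOpen_disk2 r₀
  · exact isOpen_iUnion fun i => (h i).1

theorem IsStdDomain.sliceFinite_frontier {E : Set (ℝ × ℝ)} (hE : IsStdDomain E) :
    SliceFinite (frontier E) ∧ SliceFinite (frontier (Prod.swap ⁻¹' E)) := by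
  have hswap : Tendsto (Prod.swap : ℝ × ℝ → ℝ × ℝ) (𝓝 0) (𝓝 0) :=
    continuous_swap.tendsto' _ _ rfl
  have hfr : frontier (Prod.swap ⁻¹' E) = Prod.swap ⁻¹' frontier E :=
    ((Homeomorph.prodComm ℝ ℝ).preimage_frontier E).symm
  rw [hfr]
  rcases hE with ⟨r₀, hr₀, rfl⟩ | ⟨r₀, hr₀, m, Es, Cs, rfl, -, h, hC, -⟩
  · have hev : ∀ᶠ p in 𝓝 (0 : ℝ × ℝ), p ∉ frontier (disk2 r₀) :=
      (eventually_notMem_circle2 hr₀).mono fun p hp hp' => hp (frontier_disk2_subset r₀ hp')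
    exact ⟨SliceFinite.empty.mono hev, SliceFinite.empty.mono (hswap.eventually hev)⟩
  · have hev : ∀ᶠ p in 𝓝 (0 : ℝ × ℝ), p ∈ frontier (⋃ i, Es i) →
        p ∈ ⋃ q : Fin m × Fin 2, Cs q.1 q.2 := by
      filter_upwards [eventually_notMem_circle2 hr₀] with p hp hpE
      obtain ⟨i, hi⟩ := mem_iUnion.1 (frontier_iUnion_subset Es hpE)
      rcases (h i).2.2.2 hi with (hi | hi) | hi
      · exact mem_iUnion.2 ⟨(i, 0), hi⟩
      · exact mem_iUnion.2 ⟨(i, 1), hi⟩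
      · exact absurd hi hp
    refine ⟨(SliceFinite.iUnion fun q : Fin m × Fin 2 => ((hC q.1 q.2).sliceFinite hr₀).1).mono hev,
      (SliceFinite.iUnion fun q : Fin m × Fin 2 => ((hC q.1 q.2).sliceFinite hr₀).2).mono ?_⟩
    rw [← preimage_iUnion]
    exact hswap.eventually hev

/-- On horizontal lines near the origin, other than the axis, `g` is monotone off a bounded number
of points. -/
def PiecewiseMonotoneSlices (g : ℝ × ℝ → ℝ) : Prop :=
  ∃ r > (0 : ℝ), ∃ M : ℕ, ∀ y : ℝ, y ≠ 0 → |y| < r → ∃ Z : Finset ℝ, Z.card ≤ M ∧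
    ∀ a b, Ioo a b ⊆ Ioo (-r) r → (∀ z ∈ Z, z ∉ Ioo a b) →
      MonotoneOn (fun x => g (x, y)) (Ioo a b) ∨ AntitoneOn (fun x => g (x, y)) (Ioo a b)

theorem monotoneOn_or_antitoneOn_of_deriv {φ φ' : ℝ → ℝ} {a b : ℝ}
    (hφ : ∀ x ∈ Ioo a b, HasDerivAt φ (φ' x) x)
    (h : (∀ x ∈ Ioo a b, φ' x = 0) ∨ ∀ x ∈ Ioo a b, φ' x ≠ 0) :
    MonotoneOn φ (Ioo a b) ∨ AntitoneOn φ (Ioo a b) := by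
  have hc : ContinuousOn φ (Ioo a b) := fun x hx => (hφ x hx).continuousAt.continuousWithinAt
  have hsign : (∀ x ∈ Ioo a b, φ' x ≤ 0) ∨ ∀ x ∈ Ioo a b, 0 ≤ φ' x := by
    rcases h with h | h
    · exact Or.inl fun x hx => (h x hx).le
    · exact (hasDerivWithinAt_forall_lt_or_forall_gt_of_forall_ne (convex_Ioo a b)
        (fun x hx => (hφ x hx).hasDerivWithinAt) h).imp
        (fun h x hx => (h x hx).le) (fun h x hx => (h x hx).le)
  rcases hsign with h | h
  · refine Or.inr (antitoneOn_of_hasDerivWithinAt_nonpos (convex_Ioo a b) hc (f' := φ') ?_ ?_) <;>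
      rw [interior_Ioo]
    · exact fun x hx => (hφ x hx).hasDerivWithinAt
    · exact h
  · refine Or.inl (monotoneOn_of_hasDerivWithinAt_nonneg (convex_Ioo a b) hc (f' := φ') ?_ ?_) <;>
      rw [interior_Ioo]
    · exact fun x hx => (hφ x hx).hasDerivWithinAt
    · exact h

theorem prod_abs_rpow_eq_exp {n : ℕ} {c γ : Fin n → ℝ} (hc : ∀ i, c i ≠ 0) :
    ∏ i, |c i| ^ γ i = Real.exp (∑ i, γ i * Real.log (c i)) := by
  rw [Real.exp_sum]
  refine Finset.prod_congr rfl fun i _ => ?_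
  rw [Real.rpow_def_of_pos (abs_pos.2 (hc i)), Real.log_abs, mul_comm]

theorem sum_mul_div_eq {n : ℕ} {c c' γ : Fin n → ℝ} (hc : ∀ i, c i ≠ 0) :
    ∑ i, γ i * (c' i / c i) = (∑ i, γ i * c' i * ∏ j ∈ Finset.univ.erase i, c j) / ∏ j, c j := by
  rw [Finset.sum_div]
  refine Finset.sum_congr rfl fun i _ => ?_
  rw [← Finset.mul_prod_erase Finset.univ c (Finset.mem_univ i)]
  have : ∏ j ∈ Finset.univ.erase i, c j ≠ 0 := Finset.prod_ne_zero_iff.2 fun j _ => hc j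
  field_simp [hc i]

theorem piecewiseMonotoneSlices_stdFun {n : ℕ} {f : Fin n → ℝ × ℝ → ℝ} {γ : Fin n → ℝ}
    {E : Set (ℝ × ℝ)} (hf : ∀ i, AnalyticAt ℝ (f i) 0)
    (hf0 : ∀ i, ¬ ∀ᶠ p in 𝓝 (0 : ℝ × ℝ), f i p = 0) (hE : SliceFinite (frontier E)) :
    PiecewiseMonotoneSlices (stdFun n f γ E) := by
  set D : ℝ × ℝ → ℝ := fun p =>
    ∑ i, γ i * dirDeriv (1, 0) (f i) p * ∏ j ∈ Finset.univ.erase i, f j p with hD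
  have hfd : ∀ i, AnalyticAt ℝ (dirDeriv (1, 0) (f i)) 0 := fun i =>
    ((ContinuousLinearMap.apply ℝ ℝ ((1, 0) : ℝ × ℝ)).analyticAt _).comp (hf i).fderiv
  have hDan : AnalyticAt ℝ D 0 :=
    Finset.analyticAt_fun_sum _ fun i _ => (analyticAt_const.mul (hfd i)).mul
      (Finset.analyticAt_fun_prod _ fun j _ => hf j)
  obtain ⟨S, hS, hSD⟩ : ∃ S, SliceFinite S ∧
      ((∀ᶠ p in 𝓝 (0 : ℝ × ℝ), D p = 0) ∨ ∀ p, D p = 0 → p ∈ S) := by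
    by_cases h : ∀ᶠ p in 𝓝 (0 : ℝ × ℝ), D p = 0
    · exact ⟨∅, SliceFinite.empty, Or.inl h⟩
    · exact ⟨_, sliceFinite_zeros hDan h, Or.inr fun p hp => hp⟩
  have hbad := (hE.union (SliceFinite.iUnion fun i => sliceFinite_zeros (hf i) (hf0 i))).union hS
  obtain ⟨r₁, hr₁, M, hM⟩ := hbad
  have hev : ∀ᶠ p in 𝓝 (0 : ℝ × ℝ), (∀ i, DifferentiableAt ℝ (f i) p) ∧
      (D p = 0 ∨ ∀ p, D p = 0 → p ∈ S) := by
    refine (eventually_all.2 fun i => ?_).and ?_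
    · exact (hf i).eventually_analyticAt.mono fun p hp => hp.differentiableAt
    · rcases hSD with h | h
      · exact h.mono fun p hp => Or.inl hp
      · exact .of_forall fun p => Or.inr h
  obtain ⟨r₂, hr₂, hr₂'⟩ := Metric.eventually_nhds_iff_ball.1 hev
  refine ⟨min r₁ r₂, lt_min hr₁ hr₂, M, fun y hy hyr => ?_⟩
  obtain ⟨hy1, hy2⟩ := lt_min_iff.1 hyr
  obtain ⟨Z, hZc, hZ⟩ := hM y hy hy1
  refine ⟨Z, hZc, fun a b hab hZab => ?_⟩
  have hx1 : ∀ x ∈ Ioo a b, |x| < r₁ := fun x hx =>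
    (abs_lt.2 (hab hx)).trans_le (min_le_left _ _)
  have hx2 : ∀ x ∈ Ioo a b, (x, y) ∈ ball (0 : ℝ × ℝ) r₂ := fun x hx =>
    mem_ball_zero_prod.2 ⟨(abs_lt.2 (hab hx)).trans_le (min_le_right _ _), hy2⟩
  have hgood : ∀ x ∈ Ioo a b,
      (x, y) ∉ (frontier E ∪ ⋃ i, {p | f i p = 0}) ∪ S :=
    fun x hx hbad => hZab x (hZ x (hx1 x hx) hbad) hx
  have hfr : ∀ x ∈ Ioo a b, (x, y) ∉ frontier E := fun x hx h => hgood x hx (.inl (.inl h))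
  have hfne : ∀ x ∈ Ioo a b, ∀ i, f i (x, y) ≠ 0 := fun x hx i h =>
    hgood x hx (.inl (.inr (mem_iUnion.2 ⟨i, h⟩)))
  have hDS : ∀ x ∈ Ioo a b, (x, y) ∉ S := fun x hx h => hgood x hx (.inr h)
  have hconn : IsPreconnected (Set.image (fun x : ℝ => (x, y)) (Ioo a b)) :=
    isPreconnected_Ioo.image _ (by fun_prop)
  have hsub := hconn.subset_or_subset (u := interior E) (v := (closure E)ᶜ) isOpen_interior
    isClosed_closure.isOpen_compl
    (disjoint_compl_right.mono_left (interior_subset.trans subset_closure)) (by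
      rintro _ ⟨x, hx, rfl⟩
      by_cases h : (x, y) ∈ closure E
      · exact Or.inl (by_contra fun h' => hfr x hx ⟨h, h'⟩)
      · exact Or.inr h)
  rcases hsub with hsub | hsub
  · set φ : ℝ → ℝ := fun x => ∑ i, γ i * Real.log (f i (x, y)) with hφ
    have heq : EqOn (fun x => stdFun n f γ E (x, y)) (fun x => Real.exp (φ x)) (Ioo a b) := by
      intro x hx
      have hxE : (x, y) ∈ E := interior_subset (hsub ⟨x, hx, rfl⟩)
      simp only [stdFun, indicator_of_mem hxE]
      exact prod_abs_rpow_eq_exp (hfne x hx)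
    have hder : ∀ x ∈ Ioo a b, HasDerivAt φ (D (x, y) / ∏ j, f j (x, y)) x := by
      intro x hx
      rw [hD]
      simp only
      rw [← sum_mul_div_eq (hfne x hx)]
      exact HasDerivAt.fun_sum fun i _ =>
        ((hasDerivAt_slice_fst ((hr₂' _ (hx2 x hx)).1 i)).log (hfne x hx i)).const_mul (γ i)
    have hmono := monotoneOn_or_antitoneOn_of_deriv hder (by
      rcases (Ioo a b).eq_empty_or_nonempty with h | ⟨x₀, hx₀⟩
      · exact Or.inl (by simp [h])
      by_cases hDz : ∀ p, D p = 0 → p ∈ S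
      · exact Or.inr fun x hx => div_ne_zero (fun h => hDS x hx (hDz _ h))
          (Finset.prod_ne_zero_iff.2 fun j _ => hfne x hx j)
      · exact Or.inl fun x hx => by
          rw [((hr₂' _ (hx2 x hx)).2.resolve_right hDz), zero_div])
    refine hmono.imp (fun h => ?_) (fun h => ?_)
    · exact MonotoneOn.congr (fun x hx z hz hxz => Real.exp_le_exp.2 (h hx hz hxz)) heq.symm
    · exact AntitoneOn.congr (fun x hx z hz hxz => Real.exp_le_exp.2 (h hx hz hxz)) heq.symm
  · left
    have hzero : ∀ x ∈ Ioo a b, stdFun n f γ E (x, y) = 0 := fun x hx =>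
      indicator_of_notMem (fun h => hsub ⟨x, hx, rfl⟩ (subset_closure h)) _
    intro x hx z hz _
    simp only [hzero x hx, hzero z hz, le_refl]

theorem lintegral_planar_shift_le {G : ℝ × ℝ → ℝ} (hG : Measurable G) (h0 : ∀ p, 0 ≤ G p)
    {r δ c : ℝ} (hδ : 0 ≤ δ) (hc : 0 ≤ c) {M : ℕ}
    (hM : ∀ y : ℝ, y ≠ 0 → |y| < r → ∃ Z : Finset ℝ, Z.card ≤ M ∧
      ∀ a b, Ioo a b ⊆ Ioo (-r) r → (∀ z ∈ Z, z ∉ Ioo a b) →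
        MonotoneOn (fun x => G (x, y)) (Ioo a b) ∨ AntitoneOn (fun x => G (x, y)) (Ioo a b)) :
    ∫⁻ w in {w | w ∈ ball (0 : ℝ × ℝ) r ∧ w + (δ, 0) ∈ ball (0 : ℝ × ℝ) r},
        ‖G (w + (δ, 0)) - G w‖ₑ ≤
      (M + 2 : ℕ) * (4 * (ENNReal.ofReal (2 * r) * ENNReal.ofReal (c * δ) +
        ∫⁻ w, excess c G w)) := by
  set S : Set (ℝ × ℝ) := {w | w ∈ ball (0 : ℝ × ℝ) r ∧ w + (δ, 0) ∈ ball (0 : ℝ × ℝ) r} with hS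
  have hshift : Measurable fun w : ℝ × ℝ => w + (δ, 0) := measurable_id.add_const _
  have hSm : MeasurableSet S := measurableSet_ball.inter (hshift measurableSet_ball)
  have hF : Measurable fun w => ‖G (w + (δ, 0)) - G w‖ₑ := ((hG.comp hshift).sub hG).enorm
  have hX : Measurable (excess c G) := measurable_excess hG c
  rw [← lintegral_indicator hSm, Measure.volume_eq_prod,
    lintegral_prod_symm' _ (hF.indicator hSm), lintegral_prod_symm' _ hX]
  have hline : ∀ᵐ y : ℝ, ∫⁻ x, S.indicator (fun w => ‖G (w + (δ, 0)) - G w‖ₑ) (x, y) ≤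
      (Ioo (-r) r).indicator (fun y => (M + 2 : ℕ) * (4 * (ENNReal.ofReal (c * δ) +
        ∫⁻ x, excess c G (x, y)))) y := by
    have hne : ∀ᵐ y : ℝ, y ≠ 0 := Measure.ae_ne volume 0
    filter_upwards [hne] with y hy
    by_cases hyr : |y| < r
    · obtain ⟨Z, hZc, hZ⟩ := hM y hy hyr
      have hyI : y ∈ Ioo (-r) r := abs_lt.1 hyr
      rw [indicator_of_mem hyI]
      have hGy : Measurable fun x => G (x, y) := hG.comp (by fun_prop)
      have hset : MeasurableSet {x : ℝ | x ∈ Ioo (-r) r ∧ x + δ ∈ Ioo (-r) r} :=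
        measurableSet_Ioo.inter ((measurable_id.add_const δ) measurableSet_Ioo)
      have heq : (fun x => S.indicator (fun w => ‖G (w + (δ, 0)) - G w‖ₑ) (x, y)) =
          {x : ℝ | x ∈ Ioo (-r) r ∧ x + δ ∈ Ioo (-r) r}.indicator
            (fun x => ‖G (x + δ, y) - G (x, y)‖ₑ) := by
        ext x
        have hiff : (x, y) ∈ S ↔ x ∈ {x : ℝ | x ∈ Ioo (-r) r ∧ x + δ ∈ Ioo (-r) r} := by
          have : ((x, y) : ℝ × ℝ) + (δ, 0) = (x + δ, y) := by simp
          change ((x, y) ∈ ball (0 : ℝ × ℝ) r ∧ (x, y) + (δ, 0) ∈ ball (0 : ℝ × ℝ) r) ↔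
            (x ∈ Ioo (-r) r ∧ x + δ ∈ Ioo (-r) r)
          rw [this, mem_ball_zero_prod, mem_ball_zero_prod, abs_lt, abs_lt (a := x + δ)]
          simp only [hyr, and_true, mem_Ioo]
        by_cases hx : (x, y) ∈ S
        · rw [indicator_of_mem hx, indicator_of_mem (hiff.1 hx)]
          simp
        · rw [indicator_of_notMem hx, indicator_of_notMem fun h => hx (hiff.2 h)]
      rw [heq, lintegral_indicator hset]
      refine (lintegral_shift_sub_le_of_piecewise (c := c) hGy (fun x => h0 _) hδ hc Z hZ).trans ?_
      gcongr
      exact le_rfl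
    · refine (lintegral_eq_zero_of_ae_eq_zero (.of_forall fun x => ?_)).trans_le zero_le
      exact indicator_of_notMem (fun h => hyr (mem_ball_zero_prod.1 h.1).2) _
  have hXy : Measurable fun y => ∫⁻ x, excess c G (x, y) := hX.lintegral_prod_left'
  refine (lintegral_mono_ae hline).trans ?_
  rw [lintegral_indicator measurableSet_Ioo, lintegral_const_mul _ (by fun_prop),
    lintegral_const_mul _ (by fun_prop), lintegral_add_left measurable_const, setLIntegral_const,
    Real.volume_Ioo, sub_neg_eq_add, ← two_mul r, mul_comm (ENNReal.ofReal (c * δ))]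
  gcongr
  exact Measure.restrict_le_self

/-- A quantitative control of the `L¹` modulus of continuity of `g` near the origin in the
direction `e`. -/
def ShiftControl (g : ℝ × ℝ → ℝ) (e : ℝ × ℝ) : Prop :=
  ∃ r₀ > (0 : ℝ), ∃ M : ℕ, ∀ r, 0 < r → r ≤ r₀ → Measurable ((ball 0 r).indicator g) →
    ∀ δ c : ℝ, 0 ≤ δ → 0 ≤ c →
      ∫⁻ w in {w | w ∈ ball (0 : ℝ × ℝ) r ∧ w + δ • e ∈ ball (0 : ℝ × ℝ) r},
          ‖g (w + δ • e) - g w‖ₑ ≤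
        M * (ENNReal.ofReal (2 * r) * ENNReal.ofReal (c * δ) +
          ∫⁻ w, excess c ((ball 0 r).indicator g) w)

theorem PiecewiseMonotoneSlices.shiftControl {g : ℝ × ℝ → ℝ} (hg : PiecewiseMonotoneSlices g)
    (h0 : ∀ p, 0 ≤ g p) : ShiftControl g (1, 0) := by
  obtain ⟨r₀, hr₀, M, hM⟩ := hg
  refine ⟨r₀, hr₀, (M + 2) * 4, fun r hr hrr₀ hmeas δ c hδ hc => ?_⟩
  have key := lintegral_planar_shift_le (r := r) (M := M) hmeas
    (fun p => indicator_nonneg (fun p _ => h0 p) p) hδ hc (by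
      intro y hy hyr
      obtain ⟨Z, hZc, hZ⟩ := hM y hy (hyr.trans_le hrr₀)
      refine ⟨Z, hZc, fun a b hab hZab => ?_⟩
      have heq : EqOn (fun x => g (x, y)) (fun x => (ball 0 r).indicator g (x, y)) (Ioo a b) :=
        fun x hx => (indicator_of_mem
          (mem_ball_zero_prod.2 ⟨abs_lt.2 (hab hx), hyr⟩) g).symm
      exact (hZ a b (hab.trans (Ioo_subset_Ioo (neg_le_neg hrr₀) hrr₀)) hZab).imp
        (fun h => h.congr heq) (fun h => h.congr heq))
  have he : δ • ((1, 0) : ℝ × ℝ) = (δ, 0) := by simp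
  have hSm : MeasurableSet {w | w ∈ ball (0 : ℝ × ℝ) r ∧ w + (δ, 0) ∈ ball (0 : ℝ × ℝ) r} :=
    measurableSet_ball.inter ((measurable_id.add_const _) measurableSet_ball)
  rw [he]
  refine (setLIntegral_congr_fun hSm fun w hw => ?_).trans_le (key.trans_eq ?_)
  · simp only [indicator_of_mem hw.1, indicator_of_mem hw.2]
  · push_cast; ring

theorem swap_mem_ball_zero {p : ℝ × ℝ} {r : ℝ} :
    p.swap ∈ ball (0 : ℝ × ℝ) r ↔ p ∈ ball (0 : ℝ × ℝ) r := by
  rcases p with ⟨x, y⟩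
  rw [Prod.swap_prod_mk, mem_ball_zero_prod, mem_ball_zero_prod, and_comm]

theorem lintegral_swap_plane (F : ℝ × ℝ → ℝ≥0∞) : ∫⁻ w : ℝ × ℝ, F w.swap = ∫⁻ w, F w :=
  (Measure.measurePreserving_swap (μ := (volume : Measure ℝ))
    (ν := (volume : Measure ℝ))).lintegral_comp_emb MeasurableEquiv.prodComm.measurableEmbedding F

theorem ShiftControl.of_swap {g : ℝ × ℝ → ℝ}
    (hg : ShiftControl (fun p : ℝ × ℝ => g p.swap) (1, 0)) :
    ShiftControl g (0, 1) := by
  obtain ⟨r₀, hr₀, M, hM⟩ := hg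
  refine ⟨r₀, hr₀, M, fun r hr hrr₀ hmeas δ c hδ hc => ?_⟩
  have hind : (ball 0 r).indicator (fun p : ℝ × ℝ => g p.swap) =
      fun p : ℝ × ℝ => (ball 0 r).indicator g p.swap := by
    ext p
    by_cases hp : p ∈ ball (0 : ℝ × ℝ) r
    · rw [indicator_of_mem hp, indicator_of_mem (swap_mem_ball_zero.2 hp)]
    · rw [indicator_of_notMem hp, indicator_of_notMem (fun h => hp (swap_mem_ball_zero.1 h))]
  have key := hM r hr hrr₀ (by rw [hind]; exact hmeas.comp measurable_swap) δ c hδ hc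
  have hX : ∫⁻ w, excess c ((ball 0 r).indicator fun p : ℝ × ℝ => g p.swap) w =
      ∫⁻ w, excess c ((ball 0 r).indicator g) w := by
    rw [← lintegral_swap_plane, hind]
    exact lintegral_congr fun w => by simp [excess, indicator]
  have hset : ∀ e : ℝ × ℝ, MeasurableSet
      {w | w ∈ ball (0 : ℝ × ℝ) r ∧ w + δ • e ∈ ball (0 : ℝ × ℝ) r} := fun e =>
    measurableSet_ball.inter ((measurable_id.add_const _) measurableSet_ball)
  rw [hX] at key
  refine Eq.trans_le ?_ key
  rw [← lintegral_indicator (hset _), ← lintegral_indicator (hset _), ← lintegral_swap_plane]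
  refine lintegral_congr fun w => ?_
  have hs : (w + δ • ((1, 0) : ℝ × ℝ)).swap = w.swap + δ • ((0, 1) : ℝ × ℝ) := by
    rcases w with ⟨x, y⟩; simp
  have hiff : w.swap ∈ {w | w ∈ ball (0 : ℝ × ℝ) r ∧ w + δ • ((0, 1) : ℝ × ℝ) ∈ ball 0 r} ↔
      w ∈ {w | w ∈ ball (0 : ℝ × ℝ) r ∧ w + δ • ((1, 0) : ℝ × ℝ) ∈ ball 0 r} := by
    rw [mem_ofPred_eq, mem_ofPred_eq, ← hs, swap_mem_ball_zero, swap_mem_ball_zero]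
  by_cases hw : w ∈ {w | w ∈ ball (0 : ℝ × ℝ) r ∧ w + δ • ((1, 0) : ℝ × ℝ) ∈ ball 0 r}
  · rw [indicator_of_mem hw, indicator_of_mem (hiff.2 hw), ← hs]
  · rw [indicator_of_notMem hw, indicator_of_notMem fun h => hw (hiff.1 h)]

theorem stdFun_nonneg (n : ℕ) (f : Fin n → ℝ × ℝ → ℝ) (γ : Fin n → ℝ) (E : Set (ℝ × ℝ))
    (p : ℝ × ℝ) : 0 ≤ stdFun n f γ E p :=
  indicator_nonneg (fun _ _ => Finset.prod_nonneg fun _ _ => Real.rpow_nonneg (abs_nonneg _) _) p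

theorem StandardForm.shiftControl {n : ℕ} {f : Fin n → ℝ × ℝ → ℝ} {γ : Fin n → ℝ}
    {E : Set (ℝ × ℝ)} (h : StandardForm n f γ E) :
    ShiftControl (stdFun n f γ E) (1, 0) ∧ ShiftControl (stdFun n f γ E) (0, 1) := by
  obtain ⟨U, hU, hf⟩ := h.analytic
  have hf0 : ∀ i, AnalyticAt ℝ (f i) 0 := fun i => hf i 0 (mem_of_mem_nhds hU)
  have hswap : Tendsto (Prod.swap : ℝ × ℝ → ℝ × ℝ) (𝓝 0) (𝓝 0) :=
    continuous_swap.tendsto' _ _ rfl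
  refine ⟨(piecewiseMonotoneSlices_stdFun hf0 h.nontriv
    h.domain.sliceFinite_frontier.1).shiftControl (stdFun_nonneg n f γ E), ?_⟩
  refine ShiftControl.of_swap
    (PiecewiseMonotoneSlices.shiftControl ?_ fun p => stdFun_nonneg _ _ _ _ _)
  refine piecewiseMonotoneSlices_stdFun (f := fun i (p : ℝ × ℝ) => f i p.swap) (γ := γ)
    (E := Prod.swap ⁻¹' E) (fun i => ?_) (fun i hev => h.nontriv i ?_)
    h.domain.sliceFinite_frontier.2
  · have : AnalyticAt ℝ (fun p : ℝ × ℝ => (p.2, p.1)) 0 := analyticAt_snd.prod analyticAt_fst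
    exact AnalyticAt.comp (g := f i) (f := fun p : ℝ × ℝ => (p.2, p.1)) (hf0 i) this
  · exact (hswap.eventually hev).mono fun p hp => by simpa using hp

theorem StandardForm.exists_measurable {n : ℕ} {f : Fin n → ℝ × ℝ → ℝ} {γ : Fin n → ℝ}
    {E : Set (ℝ × ℝ)} (h : StandardForm n f γ E) :
    ∃ r₀ > (0 : ℝ), ∀ r, r ≤ r₀ → Measurable ((ball 0 r).indicator (stdFun n f γ E)) := by
  obtain ⟨U, hU, hf⟩ := h.analytic
  obtain ⟨r₀, hr₀, hsub⟩ := Metric.mem_nhds_iff.1 hU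
  refine ⟨r₀, hr₀, fun r hr => ?_⟩
  have hfm : ∀ i, Measurable ((ball 0 r).indicator (f i)) := by
    intro i
    have hc : ContinuousOn (f i) (ball 0 r) :=
      (hf i).continuousOn.mono ((ball_subset_ball hr).trans hsub)
    classical
    rw [← Set.piecewise_eq_indicator]
    exact hc.measurable_piecewise continuous_zero.continuousOn measurableSet_ball
  have hm : Measurable (stdFun n (fun i => (ball 0 r).indicator (f i)) γ E) :=
    (Finset.measurable_fun_prod _ fun i _ => (hfm i).norm.pow_const (γ i)).indicator
      h.domain.isOpen.measurableSet
  convert hm.indicator (measurableSet_ball (x := (0 : ℝ × ℝ)) (ε := r)) using 1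
  ext p
  by_cases hp : p ∈ ball (0 : ℝ × ℝ) r
  · simp only [stdFun, indicator, hp, if_true]
  · rw [indicator_of_notMem hp, indicator_of_notMem hp]

theorem norm_le_nrm2 (p : ℝ × ℝ) : ‖p‖ ≤ nrm2 p := by
  rw [Prod.norm_def, max_le_iff, Real.norm_eq_abs, Real.norm_eq_abs]
  exact ⟨Real.abs_le_sqrt (by nlinarith [sq_nonneg p.2]),
    Real.abs_le_sqrt (by nlinarith [sq_nonneg p.1])⟩

theorem nrm2_le_two_mul_norm (p : ℝ × ℝ) : nrm2 p ≤ 2 * ‖p‖ := by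
  have h1 : |p.1| ≤ ‖p‖ := norm_fst_le p
  have h2 : |p.2| ≤ ‖p‖ := norm_snd_le p
  refine Real.sqrt_le_iff.2 ⟨by positivity, ?_⟩
  nlinarith [sq_abs p.1, sq_abs p.2, abs_nonneg p.1, abs_nonneg p.2]

theorem AlphaBound.abs_shift_sub_le {α : ℝ × ℝ → ℝ} {A : ℝ} (h : AlphaBound α A)
    {w : ℝ × ℝ} (hw : w ≠ 0) (v : ℝ × ℝ) :
    |α (w + v) - α w| ≤ 4 * A * ‖v‖ * ‖w‖⁻¹ := by
  obtain ⟨hC, hb, hd⟩ := h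
  have hA : 0 ≤ A := (abs_nonneg _).trans (hb 0)
  have hw0 : 0 < ‖w‖ := norm_pos_iff.2 hw
  rw [← div_eq_mul_inv, le_div_iff₀ hw0]
  rcases le_total (2 * ‖v‖) ‖w‖ with hvw | hvw
  · have hlow : ∀ x ∈ closedBall w ‖v‖, ‖w‖ / 2 ≤ ‖x‖ := by
      intro x hx
      have h1 := norm_sub_norm_le w x
      rw [norm_sub_rev] at h1
      have h2 := mem_closedBall_iff_norm.1 hx
      linarith
    have hne : ∀ x ∈ closedBall w ‖v‖, x ≠ 0 := fun x hx =>
      norm_pos_iff.1 ((half_pos hw0).trans_le (hlow x hx))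
    have key := Convex.norm_image_sub_le_of_norm_fderiv_le (𝕜 := ℝ) (f := α)
      (C := A * (‖w‖ / 2)⁻¹) (s := closedBall w ‖v‖) (x := w) (y := w + v)
      (fun x hx => (hC.differentiableOn one_ne_zero).differentiableAt
        (isOpen_compl_singleton.mem_nhds (hne x hx)))
      (fun x hx => (hd x (hne x hx)).trans (by
        have := (hlow x hx).trans (norm_le_nrm2 x)
        gcongr))
      (convex_closedBall w ‖v‖) (mem_closedBall_self (norm_nonneg v)) (by simp)
    rw [Real.norm_eq_abs, add_sub_cancel_left] at key
    calc |α (w + v) - α w| * ‖w‖ ≤ A * (‖w‖ / 2)⁻¹ * ‖v‖ * ‖w‖ := by gcongr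
      _ = 2 * A * ‖v‖ := by field_simp
      _ ≤ 4 * A * ‖v‖ := by gcongr; norm_num
  · have h2 : |α (w + v) - α w| ≤ 2 * A :=
      (abs_sub _ _).trans (by linarith [hb (w + v), hb w])
    calc |α (w + v) - α w| * ‖w‖ ≤ 2 * A * (2 * ‖v‖) := by gcongr
      _ = 4 * A * ‖v‖ := by ring

theorem setLIntegral_ball_inv_norm_lt_top (r : ℝ) :
    ∫⁻ w in ball (0 : ℝ × ℝ) r, ENNReal.ofReal ‖w‖⁻¹ < ⊤ := by
  have hfi : Integrable (fun w : ℝ × ℝ => (Iio r).indicator (fun y : ℝ => y⁻¹) ‖w‖) := by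
    rw [integrable_fun_norm_addHaar (μ := (volume : Measure (ℝ × ℝ)))]
    have h1 : IntegrableOn (fun _ : ℝ => (1 : ℝ)) (Ioo 0 r) :=
      integrableOn_const (by simp)
    have h2 : IntegrableOn ((Iio r).indicator fun _ : ℝ => (1 : ℝ)) (Ioi 0) := by
      rw [integrableOn_indicator_iff measurableSet_Iio, inter_comm, Ioi_inter_Iio]
      exact h1
    refine h2.congr_fun (fun y hy => ?_) measurableSet_Ioi
    have hy0 : y ≠ 0 := ne_of_gt hy
    by_cases hyr : y ∈ Iio r
    · simp [indicator_of_mem hyr, hy0]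
    · simp [indicator_of_notMem hyr]
  rw [← lintegral_indicator measurableSet_ball]
  refine lt_of_eq_of_lt (lintegral_congr fun w => ?_) hfi.lintegral_lt_top
  by_cases hw : ‖w‖ < r <;> simp [indicator, hw]

/-- The level at which to truncate an `L^p` function at scale `δ`. -/
theorem MeasureTheory.MemLp.exists_truncation_level {X : Type*} [MeasurableSpace X]
    {μ : Measure X} {G : X → ℝ} (h0 : ∀ x, 0 ≤ G x) {p : ℝ≥0∞} (hp : 1 < p)
    (hG : MemLp G p μ) :
    ∃ C : ℝ, 0 ≤ C ∧ ∀ δ : ℝ, 0 < δ → ∃ c : ℝ, 0 ≤ c ∧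
      c * δ ≤ C * δ ^ (1 - (p⁻¹).toReal) ∧
      ∫⁻ x, excess c G x ∂μ ≤ ENNReal.ofReal (C * δ ^ (1 - (p⁻¹).toReal)) := by
  rcases eq_or_ne p ⊤ with rfl | hptop
  · refine ⟨(eLpNormEssSup G μ).toReal, ENNReal.toReal_nonneg, fun δ hδ =>
      ⟨(eLpNormEssSup G μ).toReal, ENNReal.toReal_nonneg, by simp, ?_⟩⟩
    have hfin : eLpNormEssSup G μ ≠ ⊤ := by
      have := hG.eLpNorm_ne_top
      rwa [eLpNorm_exponent_top] at this
    refine (lintegral_eq_zero_of_ae_eq_zero ?_).trans_le zero_le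
    filter_upwards [ae_le_eLpNormEssSup (f := G) (μ := μ)] with x hx
    have hle : G x ≤ (eLpNormEssSup G μ).toReal := by
      rw [← Real.norm_of_nonneg (h0 x), ← toReal_enorm]
      exact ENNReal.toReal_mono hfin hx
    exact indicator_of_notMem (fun h : _ < G x => h.not_ge hle) _
  · have hp0 : p ≠ 0 := (zero_lt_one.trans hp).ne'
    set q := p.toReal with hq
    have hq1 : 1 < q := by
      rw [hq, ← ENNReal.toReal_one]
      exact (ENNReal.toReal_lt_toReal ENNReal.one_ne_top hptop).2 hp
    have hq0 : 0 < q := zero_lt_one.trans hq1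
    have hfi := (hG.integrable_norm_rpow hp0 hptop).lintegral_lt_top
    set I := ∫⁻ x, ENNReal.ofReal (‖G x‖ ^ q) ∂μ with hI
    rw [ENNReal.toReal_inv]
    refine ⟨1 + I.toReal, by positivity, fun δ hδ => ⟨δ ^ (-q⁻¹), by positivity, ?_, ?_⟩⟩
    · have : δ ^ (-q⁻¹) * δ = δ ^ (1 - q⁻¹) := by
        rw [sub_eq_add_neg, Real.rpow_add hδ, Real.rpow_one, mul_comm]
      rw [this]
      exact le_mul_of_one_le_left (by positivity) (by simp)
    · have hc : 0 < δ ^ (-q⁻¹) := by positivity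
      have hpow : (δ ^ (-q⁻¹)) ^ (1 - q) = δ ^ (1 - q⁻¹) := by
        rw [← Real.rpow_mul hδ.le]
        congr 1
        field_simp
        ring
      calc ∫⁻ x, excess (δ ^ (-q⁻¹)) G x ∂μ
          ≤ ∫⁻ x, ENNReal.ofReal (δ ^ (1 - q⁻¹)) * ENNReal.ofReal (‖G x‖ ^ q) ∂μ := by
            refine lintegral_mono fun x => ?_
            by_cases hx : δ ^ (-q⁻¹) < G x
            · have hGx : 0 < G x := hc.trans hx
              rw [excess, indicator_of_mem (by exact hx), ← ENNReal.ofReal_mul (by positivity)]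
              refine ENNReal.ofReal_le_ofReal ?_
              calc G x = G x ^ (1 - q) * G x ^ q := by
                    rw [← Real.rpow_add hGx, sub_add_cancel, Real.rpow_one]
                _ ≤ δ ^ (1 - q⁻¹) * ‖G x‖ ^ q := by
                    rw [Real.norm_of_nonneg hGx.le, ← hpow]
                    gcongr ?_ * _
                    exact Real.rpow_le_rpow_of_nonpos hc hx.le (by linarith)
            · rw [excess, indicator_of_notMem (by exact hx)]
              exact zero_le
        _ = ENNReal.ofReal (δ ^ (1 - q⁻¹)) * I := lintegral_const_mul' _ _ ENNReal.ofReal_ne_top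
        _ ≤ ENNReal.ofReal ((1 + I.toReal) * δ ^ (1 - q⁻¹)) := by
            rw [mul_comm (1 + I.toReal), ENNReal.ofReal_mul (by positivity)]
            gcongr
            conv_lhs => rw [← ENNReal.ofReal_toReal hfi.ne]
            exact ENNReal.ofReal_le_ofReal (by simp)

/-- The `L¹` modulus of continuity of `α · g` near the origin is controlled by the one of `g`. -/
theorem AlphaBound.exists_lintegral_shift_le {α g : ℝ × ℝ → ℝ} {A : ℝ} (hα : AlphaBound α A)
    (h0 : ∀ x, 0 ≤ g x) {e : ℝ × ℝ} (he : ‖e‖ = 1) {p : ℝ≥0∞} (hp : 1 < p)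
    (hg : ShiftControl g e)
    (hgm : ∃ r₀ > (0 : ℝ), ∀ r, r ≤ r₀ → Measurable ((ball 0 r).indicator g))
    (hN : ∃ N ∈ 𝓝 (0 : ℝ × ℝ), MemLp g p (volume.restrict N))
    {U : Set (ℝ × ℝ)} (hU : U ∈ 𝓝 (0 : ℝ × ℝ)) :
    ∃ r > (0 : ℝ), ball 0 r ⊆ U ∧ ∃ B : ℝ≥0∞, B ≠ ⊤ ∧ ∀ δ : ℝ, 0 < δ →
      ∫⁻ w in {w | w ∈ ball (0 : ℝ × ℝ) r ∧ w + δ • e ∈ ball (0 : ℝ × ℝ) r},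
          ‖α (w + δ • e) * g (w + δ • e) - α w * g w‖ₑ ≤
        B * ENNReal.ofReal (δ ^ (1 - (p⁻¹).toReal)) := by
  obtain ⟨r₁, hr₁, M, hM⟩ := hg
  obtain ⟨r₂, hr₂, hmeas⟩ := hgm
  obtain ⟨N, hN, hLp⟩ := hN
  obtain ⟨r₃, hr₃, hsub⟩ := Metric.mem_nhds_iff.1 (inter_mem hN hU)
  have hA : 0 ≤ A := (abs_nonneg _).trans (hα.2.1 0)
  set r := min r₁ (min r₂ r₃) with hr
  have hr0 : 0 < r := lt_min hr₁ (lt_min hr₂ hr₃)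
  have hrr₁ : r ≤ r₁ := min_le_left _ _
  have hrr₂ : r ≤ r₂ := (min_le_right _ _).trans (min_le_left _ _)
  have hrsub : ball 0 r ⊆ N ∩ U :=
    (ball_subset_ball ((min_le_right _ _).trans (min_le_right _ _))).trans hsub
  set G := (ball (0 : ℝ × ℝ) r).indicator g with hG
  have hGm : Measurable G := hmeas r hrr₂
  have hG0 : ∀ x, 0 ≤ G x := fun x => indicator_nonneg (fun x _ => h0 x) x
  have hGLp : MemLp G p := (memLp_indicator_iff_restrict measurableSet_ball).2
    (hLp.mono_measure (Measure.restrict_mono (hrsub.trans inter_subset_left) le_rfl))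
  obtain ⟨C, hC, hlevel⟩ := hGLp.exists_truncation_level hG0 hp
  set J := ∫⁻ w in ball (0 : ℝ × ℝ) r, ENNReal.ofReal ‖w‖⁻¹ with hJ
  have hJtop : J ≠ ⊤ := (setLIntegral_ball_inv_norm_lt_top r).ne
  refine ⟨r, hr0, hrsub.trans inter_subset_right,
    ENNReal.ofReal (4 * A) * ENNReal.ofReal C * J + ENNReal.ofReal (2 * A) * ENNReal.ofReal C +
      ENNReal.ofReal A * (M * (ENNReal.ofReal (2 * r) * ENNReal.ofReal C + ENNReal.ofReal C)),
    ?_, fun δ hδ => ?_⟩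
  · finiteness
  obtain ⟨c, hc, hcδ, hexc⟩ := hlevel δ hδ
  set D := ENNReal.ofReal (δ ^ (1 - (p⁻¹).toReal)) with hD
  have hCD : ENNReal.ofReal (C * δ ^ (1 - (p⁻¹).toReal)) = ENNReal.ofReal C * D :=
    ENNReal.ofReal_mul hC
  rw [hCD] at hexc
  have hcδ' : ENNReal.ofReal (c * δ) ≤ ENNReal.ofReal C * D :=
    (ENNReal.ofReal_le_ofReal hcδ).trans_eq hCD
  have hshift := hM r hr0 hrr₁ hGm δ c hδ.le hc
  set S := {w | w ∈ ball (0 : ℝ × ℝ) r ∧ w + δ • e ∈ ball (0 : ℝ × ℝ) r} with hS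
  have hSm : MeasurableSet S :=
    measurableSet_ball.inter ((measurable_id.add_const _) measurableSet_ball)
  have hv : ‖δ • e‖ = δ := by rw [norm_smul, he, mul_one, Real.norm_of_nonneg hδ.le]
  have hpt : ∀ᵐ w ∂(volume.restrict S),
      ‖α (w + δ • e) * g (w + δ • e) - α w * g w‖ₑ ≤
        (ENNReal.ofReal (4 * A) * ENNReal.ofReal (c * δ) * ENNReal.ofReal ‖w‖⁻¹ +
          ENNReal.ofReal (2 * A) * excess c G w) +
          ENNReal.ofReal A * ‖g (w + δ • e) - g w‖ₑ := by
    filter_upwards [ae_restrict_mem hSm, ae_restrict_of_ae (Measure.ae_ne volume 0)] with w hwS hw0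
    have hGw : G w = g w := indicator_of_mem hwS.1 g
    have hdα := hα.abs_shift_sub_le hw0 (δ • e)
    rw [hv] at hdα
    have hdα' : |α (w + δ • e) - α w| ≤ 2 * A :=
      (abs_sub _ _).trans (by linarith [hα.2.1 (w + δ • e), hα.2.1 w])
    have hsplit : α (w + δ • e) * g (w + δ • e) - α w * g w =
        (α (w + δ • e) - α w) * g w + α (w + δ • e) * (g (w + δ • e) - g w) := by ring
    rw [hsplit]
    refine (enorm_add_le _ _).trans (add_le_add ?_ ?_)
    · rw [enorm_mul, Real.enorm_eq_ofReal (h0 w)]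
      have hle := ofReal_le_add_excess c G w
      rw [hGw] at hle
      refine (mul_le_mul_right hle _).trans ?_
      rw [mul_add, Real.enorm_eq_ofReal_abs]
      refine add_le_add ?_ (by gcongr)
      rw [← ENNReal.ofReal_mul (by positivity), ← ENNReal.ofReal_mul (by positivity),
        ← ENNReal.ofReal_mul (by positivity)]
      refine ENNReal.ofReal_le_ofReal ((mul_le_mul_of_nonneg_right hdα hc).trans_eq (by ring))
    · rw [enorm_mul, Real.enorm_eq_ofReal_abs]
      gcongr
      exact hα.2.1 _
  refine (lintegral_mono_ae hpt).trans ?_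
  have hXm : Measurable (excess c G) := measurable_excess hGm c
  rw [lintegral_add_left (by fun_prop), lintegral_add_left (by fun_prop),
    lintegral_const_mul' _ _ (by finiteness), lintegral_const_mul' _ _ (by finiteness),
    lintegral_const_mul' _ _ (by finiteness)]
  have hJS : ∫⁻ w in S, ENNReal.ofReal ‖w‖⁻¹ ≤ J := lintegral_mono_set fun w hw => hw.1
  have hXS : ∫⁻ w in S, excess c G w ≤ ENNReal.ofReal C * D :=
    (setLIntegral_le_lintegral _ _).trans hexc
  calc _ ≤ ENNReal.ofReal (4 * A) * (ENNReal.ofReal C * D) * J +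
        ENNReal.ofReal (2 * A) * (ENNReal.ofReal C * D) +
        ENNReal.ofReal A * (M * (ENNReal.ofReal (2 * r) * (ENNReal.ofReal C * D) +
          ENNReal.ofReal C * D)) := by
        gcongr
        refine hshift.trans ?_
        gcongr
    _ = _ := by ring

theorem HasCompactSupport.exists_lintegral_shift_le {m : ℝ × ℝ → ℝ} (hcpt : HasCompactSupport m)
    {e : ℝ × ℝ} (he : ‖e‖ = 1) {κ : ℝ}
    (hloc : ∀ q ∈ tsupport m, ∃ r > (0 : ℝ), ∃ B : ℝ≥0∞, B ≠ ⊤ ∧ ∀ δ : ℝ, 0 < δ →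
      ∫⁻ w in {w | w ∈ ball (0 : ℝ × ℝ) r ∧ w + δ • e ∈ ball (0 : ℝ × ℝ) r},
        ‖m (q + (w + δ • e)) - m (q + w)‖ₑ ≤ B * ENNReal.ofReal (δ ^ κ)) :
    ∃ B : ℝ≥0∞, B ≠ ⊤ ∧ ∀ᶠ δ in 𝓝[>] (0 : ℝ),
      ∫⁻ w, ‖m (w + δ • e) - m w‖ₑ ≤ B * ENNReal.ofReal (δ ^ κ) := by
  choose! r hr B hB hbound using hloc
  obtain ⟨t, htK, ht⟩ := hcpt.isCompact.elim_nhds_subcover (fun q => ball q (r q / 2))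
    fun q hq => ball_mem_nhds q (half_pos (hr q hq))
  have hsmall : ∀ᶠ δ in 𝓝[>] (0 : ℝ), ∀ q ∈ t, δ < r q / 2 :=
    (Filter.eventually_all_finset t).2 fun q hq =>
      mem_nhdsWithin_of_mem_nhds (Iio_mem_nhds (half_pos (hr q (htK q hq))))
  refine ⟨∑ q ∈ t, B q, ENNReal.sum_ne_top.2 fun q hq => hB q (htK q hq), ?_⟩
  filter_upwards [hsmall, self_mem_nhdsWithin] with δ hδ hδ0
  have hv : ‖δ • e‖ = δ := by
    rw [norm_smul, he, mul_one, Real.norm_of_nonneg (le_of_lt hδ0)]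
  set F : ℝ × ℝ → ℝ≥0∞ := fun w => ‖m (w + δ • e) - m w‖ₑ with hF
  set S : ℝ × ℝ → Set (ℝ × ℝ) := fun q => {w | w ∈ ball q (r q) ∧ w + δ • e ∈ ball q (r q)} with hS
  have hsupp : Function.support F ⊆ ⋃ q ∈ t, S q := by
    intro w hw
    have hor : w ∈ tsupport m ∨ w + δ • e ∈ tsupport m := by
      by_contra! hcon
      exact hw (by simp [hF, image_eq_zero_of_notMem_tsupport hcon.1,
        image_eq_zero_of_notMem_tsupport hcon.2])
    rcases hor with h | h
    · obtain ⟨q, hq, hwq⟩ := mem_iUnion₂.1 (ht h)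
      refine mem_iUnion₂.2 ⟨q, hq, ?_⟩
      rw [mem_ball_iff_norm] at hwq
      have hd := hδ q hq
      have hrq := hr q (htK q hq)
      refine ⟨mem_ball_iff_norm.2 (by linarith), mem_ball_iff_norm.2 ?_⟩
      rw [add_sub_right_comm]
      exact (norm_add_le _ _).trans_lt (by linarith)
    · obtain ⟨q, hq, hwq⟩ := mem_iUnion₂.1 (ht h)
      refine mem_iUnion₂.2 ⟨q, hq, ?_⟩
      rw [mem_ball_iff_norm] at hwq
      have hd := hδ q hq
      have hrq := hr q (htK q hq)
      refine ⟨mem_ball_iff_norm.2 ?_, mem_ball_iff_norm.2 (by linarith)⟩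
      have : w - q = (w + δ • e - q) - δ • e := by abel
      rw [this]
      exact (norm_sub_le _ _).trans_lt (by linarith)
  calc ∫⁻ w, F w = ∫⁻ w, (⋃ q ∈ t, S q).indicator F w := by rw [indicator_eq_self.2 hsupp]
    _ ≤ ∫⁻ w in ⋃ q ∈ t, S q, F w := lintegral_indicator_le _ _
    _ ≤ ∑ q ∈ t, ∫⁻ w in S q, F w := setLIntegral_biUnion_finset_le _ _ _
    _ ≤ ∑ q ∈ t, B q * ENNReal.ofReal (δ ^ κ) := Finset.sum_le_sum fun q hq => ?_
    _ = _ := (Finset.sum_mul _ _ _).symm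
  refine Eq.trans_le ?_ (hbound q (htK q hq) δ hδ0)
  have hmS : MeasurableSet (S q) :=
    measurableSet_ball.inter ((measurable_id.add_const _) measurableSet_ball)
  have hmS' : MeasurableSet
      {w | w ∈ ball (0 : ℝ × ℝ) (r q) ∧ w + δ • e ∈ ball (0 : ℝ × ℝ) (r q)} :=
    measurableSet_ball.inter ((measurable_id.add_const _) measurableSet_ball)
  rw [← lintegral_indicator hmS, ← lintegral_indicator hmS',
    ← lintegral_add_left_eq_self _ q]
  refine lintegral_congr fun w => ?_
  simp only [indicator, hS, hF, mem_ofPred_eq, mem_ball_iff_norm, add_assoc, add_sub_cancel_left,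
    sub_zero]

theorem enorm_Kfull_le_of_exp_eq_neg_one (m : ℝ × ℝ → ℝ) {t u : ℝ} {v : ℝ × ℝ}
    (hv : Complex.exp (Complex.I * ((t : ℂ) * (v.1 : ℂ) + (u : ℂ) * (v.2 : ℂ))) = -1) :
    2 * ‖Kfull m t u‖ₑ ≤ ∫⁻ w, ‖m (w + v) - m w‖ₑ := by
  set ψ : ℝ × ℝ → ℂ := fun p =>
    Complex.exp (Complex.I * ((t : ℂ) * (p.1 : ℂ) + (u : ℂ) * (p.2 : ℂ))) with hψ
  have hψn : ∀ p, ‖ψ p‖ₑ = 1 := fun p => by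
    rw [← ofReal_norm]
    have : ((t : ℂ) * (p.1 : ℂ) + (u : ℂ) * (p.2 : ℂ)) = ((t * p.1 + u * p.2 : ℝ) : ℂ) := by
      push_cast; ring
    simp only [hψ, this, mul_comm Complex.I, Complex.norm_exp_ofReal_mul_I, ENNReal.ofReal_one]
  have hψv : ∀ w, ψ (w + v) = -ψ w := fun w => by
    have : Complex.I * ((t : ℂ) * ((w + v).1 : ℂ) + (u : ℂ) * ((w + v).2 : ℂ)) =
        Complex.I * ((t : ℂ) * (w.1 : ℂ) + (u : ℂ) * (w.2 : ℂ)) +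
        Complex.I * ((t : ℂ) * (v.1 : ℂ) + (u : ℂ) * (v.2 : ℂ)) := by
      simp only [Prod.fst_add, Prod.snd_add]; push_cast; ring
    simp only [hψ]
    rw [this, Complex.exp_add, hv, mul_neg_one]
  set F : ℝ × ℝ → ℂ := fun p => (m p : ℂ) * ψ p with hF
  have hK : Kfull m t u = ∫ p, F p := by simp only [Kfull, oscInt, Measure.restrict_univ, hF, hψ]
  by_cases hfi : Integrable F
  · have hadd : ∫ w, (F w + F (w + v)) = 2 * Kfull m t u := by
      rw [integral_add hfi (hfi.comp_add_right v), integral_add_right_eq_self F v, hK, two_mul]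
    calc 2 * ‖Kfull m t u‖ₑ = ‖∫ w, (F w + F (w + v))‖ₑ := by
          rw [hadd, enorm_mul]; congr 1; simp [← ofReal_norm]
      _ ≤ ∫⁻ w, ‖F w + F (w + v)‖ₑ := enorm_integral_le_lintegral_enorm _
      _ = ∫⁻ w, ‖m (w + v) - m w‖ₑ := by
          refine lintegral_congr fun w => ?_
          have : F w + F (w + v) = -((m (w + v) - m w : ℝ) : ℂ) * ψ w := by
            simp only [hF, hψv]; push_cast; ring
          rw [this, enorm_mul, hψn, mul_one, enorm_neg, ← ofReal_norm,
            Complex.norm_real, ofReal_norm]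
  · rw [hK, integral_undef hfi]
    simp

theorem norm_Kfull_le (m : ℝ × ℝ → ℝ) (t u : ℝ) :
    ‖Kfull m t u‖ ≤ (∫⁻ w, ENNReal.ofReal ‖m w‖).toReal := by
  refine (norm_integral_le_lintegral_norm _).trans_eq ?_
  rw [Measure.restrict_univ]
  congr 2
  ext w
  have : Complex.I * ((t : ℂ) * (w.1 : ℂ) + (u : ℂ) * (w.2 : ℂ)) =
      ((t * w.1 + u * w.2 : ℝ) : ℂ) * Complex.I := by
    push_cast; ring
  rw [this, norm_mul, Complex.norm_exp_ofReal_mul_I, mul_one, Complex.norm_real]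

theorem exp_I_mul_pi_div_abs {s : ℝ} (hs : s ≠ 0) :
    Complex.exp (Complex.I * ((s : ℂ) * ((π / |s| : ℝ) : ℂ))) = -1 := by
  rcases abs_choice s with h | h
  · rw [h, ← Complex.ofReal_mul, mul_div_cancel₀ _ hs, mul_comm, Complex.exp_pi_mul_I]
  · have : s * (π / -s) = -π := by field_simp
    rw [h, ← Complex.ofReal_mul, this, Complex.ofReal_neg, mul_neg, mul_comm, Complex.exp_neg,
      Complex.exp_pi_mul_I]
    norm_num

/-- Decay of the kernel from a bound on the `L¹` modulus of continuity along the axes. -/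
theorem exists_norm_Kfull_le {m : ℝ × ℝ → ℝ} {κ : ℝ} (hκ : 0 ≤ κ)
    (hmod : ∀ e : ℝ × ℝ, e = (1, 0) ∨ e = (0, 1) → ∃ B : ℝ≥0∞, B ≠ ⊤ ∧ ∀ᶠ δ in 𝓝[>] (0 : ℝ),
      ∫⁻ w, ‖m (w + δ • e) - m w‖ₑ ≤ B * ENNReal.ofReal (δ ^ κ)) :
    ∃ C > (0 : ℝ), ∀ t u : ℝ, ‖Kfull m t u‖ ≤ C * (2 + nrm2 (t, u)) ^ (-κ) := by
  obtain ⟨B₁, hB₁, h₁⟩ := hmod _ (Or.inl rfl)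
  obtain ⟨B₂, hB₂, h₂⟩ := hmod _ (Or.inr rfl)
  obtain ⟨δ₀, hδ₀, hδ⟩ := mem_nhdsGT_iff_exists_Ioc_subset.1 (h₁.and h₂)
  have hδ₀ : 0 < δ₀ := hδ₀
  set B := (B₁ + B₂).toReal with hB
  have hBtop : B₁ + B₂ ≠ ⊤ := ENNReal.add_ne_top.2 ⟨hB₁, hB₂⟩
  set R := max 1 (π / δ₀) with hR
  have hR1 : 1 ≤ R := le_max_left _ _
  set N := (∫⁻ w, ENNReal.ofReal ‖m w‖).toReal with hN
  have hN0 : 0 ≤ N := ENNReal.toReal_nonneg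
  have hB0 : 0 ≤ B := ENNReal.toReal_nonneg
  refine ⟨B * (4 * π) ^ κ + N * (4 * R) ^ κ + 1, by positivity, fun t u => ?_⟩
  set lam := 2 + nrm2 (t, u) with hlam
  have hlam0 : 0 < lam := by have : 0 ≤ nrm2 (t, u) := Real.sqrt_nonneg _; positivity
  have hlamle : lam ≤ 2 + 2 * ‖(t, u)‖ := by
    have := nrm2_le_two_mul_norm (t, u); linarith
  have hscale : ∀ {L : ℝ}, 0 ≤ L → L ^ κ * lam ^ (-κ) = (L / lam) ^ κ := fun hL => by
    rw [Real.div_rpow hL hlam0.le, Real.rpow_neg hlam0.le, div_eq_mul_inv]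
  have hlam1 : 0 ≤ lam ^ (-κ) := by positivity
  rcases lt_or_ge ‖(t, u)‖ R with hlow | hhigh
  · have h1 : 1 ≤ (4 * R) ^ κ * lam ^ (-κ) := by
      rw [hscale (by positivity)]
      exact Real.one_le_rpow ((one_le_div hlam0).2 (by linarith)) hκ
    calc ‖Kfull m t u‖ ≤ N * 1 := by rw [mul_one]; exact norm_Kfull_le m t u
      _ ≤ N * ((4 * R) ^ κ * lam ^ (-κ)) := by gcongr
      _ ≤ (B * (4 * π) ^ κ + N * (4 * R) ^ κ + 1) * lam ^ (-κ) := by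
          have : 0 ≤ B * (4 * π) ^ κ * lam ^ (-κ) := by positivity
          nlinarith
  · have hpos : 0 < ‖(t, u)‖ := zero_lt_one.trans_le (hR1.trans hhigh)
    have hle : π / ‖(t, u)‖ ≤ δ₀ := by
      rw [div_le_iff₀ hpos, mul_comm, ← div_le_iff₀ hδ₀]
      exact (le_max_right _ _).trans hhigh
    obtain ⟨hb₁, hb₂⟩ := hδ ⟨by positivity, hle⟩
    have hKe : 2 * ‖Kfull m t u‖ₑ ≤ (B₁ + B₂) * ENNReal.ofReal ((π / ‖(t, u)‖) ^ κ) := by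
      rcases max_choice ‖t‖ ‖u‖ with hmax | hmax
      · have hn : ‖(t, u)‖ = |t| := by rw [Prod.norm_mk, hmax, Real.norm_eq_abs]
        have ht : t ≠ 0 := by rw [← abs_pos, ← hn]; exact hpos
        refine (enorm_Kfull_le_of_exp_eq_neg_one m (v := (π / ‖(t, u)‖) • (1, 0)) ?_).trans
          (hb₁.trans (by gcongr; exact le_self_add))
        rw [hn]
        simpa using exp_I_mul_pi_div_abs ht
      · have hn : ‖(t, u)‖ = |u| := by rw [Prod.norm_mk, hmax, Real.norm_eq_abs]
        have hu : u ≠ 0 := by rw [← abs_pos, ← hn]; exact hpos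
        refine (enorm_Kfull_le_of_exp_eq_neg_one m (v := (π / ‖(t, u)‖) • (0, 1)) ?_).trans
          (hb₂.trans (by gcongr; exact le_add_self))
        rw [hn]
        simpa using exp_I_mul_pi_div_abs hu
    have hKr : ‖Kfull m t u‖ ≤ B * (π / ‖(t, u)‖) ^ κ := by
      have h := ENNReal.toReal_mono (by finiteness) hKe
      rw [ENNReal.toReal_mul, ENNReal.toReal_mul, toReal_enorm,
        ENNReal.toReal_ofReal (by positivity), ENNReal.toReal_ofNat] at h
      linarith [norm_nonneg (Kfull m t u)]
    have hcmp : (π / ‖(t, u)‖) ^ κ ≤ (4 * π) ^ κ * lam ^ (-κ) := by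
      rw [hscale (by positivity)]
      refine Real.rpow_le_rpow (by positivity) ?_ hκ
      rw [div_le_div_iff₀ hpos hlam0]
      nlinarith [Real.pi_pos, hR1.trans hhigh]
    calc ‖Kfull m t u‖ ≤ B * ((4 * π) ^ κ * lam ^ (-κ)) := hKr.trans (by gcongr)
      _ ≤ (B * (4 * π) ^ κ + N * (4 * R) ^ κ + 1) * lam ^ (-κ) := by
          have : 0 ≤ N * (4 * R) ^ κ * lam ^ (-κ) := by positivity
          nlinarith

/-- **Theorem 1.7.** Suppose `m` is compactly supported and around each point of its
support has the local multiplier form with a `g` of the standard form lying in `L^p` of a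
neighborhood of the origin, `1 < p ≤ ∞`. If `1/p + 1/p' = 1` then
`|K(t,u)| ≤ C (2+|(t,u)|)^{−1/p'}` when `p < ∞`, and
`|K(t,u)| ≤ C (2+|(t,u)|)^{−1} ln(2+|(t,u)|)` when `p = ∞`. -/
theorem kernel_bound_Lp (p p' : ℝ≥0∞) (hp : 1 < p) (hp' : 1/p + 1/p' = 1)
    (m : ℝ × ℝ → ℝ) (hcpt : HasCompactSupport m)
    (hloc : ∀ q ∈ tsupport m, ∃ (n : ℕ) (f : Fin n → ℝ × ℝ → ℝ) (γ : Fin n → ℝ)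
      (E : Set (ℝ × ℝ)) (α : ℝ × ℝ → ℝ) (A : ℝ), 0 < A ∧
      StandardForm n f γ E ∧ AlphaBound α A ∧
      (∃ U ∈ 𝓝 (0:ℝ×ℝ), ∀ w ∈ U, m (q + w) = α w * stdFun n f γ E w) ∧
      (∃ N ∈ 𝓝 (0:ℝ×ℝ), MemLp (stdFun n f γ E) p (volume.restrict N))) :
    ∃ C > (0:ℝ), ∀ t u : ℝ,
      (p ≠ ∞ → ‖Kfull m t u‖ ≤ C * (2 + nrm2 (t, u)) ^ (-(1/p').toReal)) ∧
      (p = ∞ → ‖Kfull m t u‖ ≤ C * (2 + nrm2 (t, u))⁻¹ * Real.log (2 + nrm2 (t, u))) := by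
  have hκ : (1 / p').toReal = 1 - (p⁻¹).toReal := by
    have hadd := congrArg ENNReal.toReal hp'
    rw [one_div, one_div] at hp' hadd
    have hfin : p⁻¹ ≠ ⊤ ∧ p'⁻¹ ≠ ⊤ := ENNReal.add_ne_top.1 (hp' ▸ ENNReal.one_ne_top)
    rw [ENNReal.toReal_add hfin.1 hfin.2, ENNReal.toReal_one] at hadd
    rw [one_div]
    linarith
  have hmod : ∀ e : ℝ × ℝ, e = (1, 0) ∨ e = (0, 1) → ∃ B : ℝ≥0∞, B ≠ ⊤ ∧
      ∀ᶠ δ in 𝓝[>] (0 : ℝ), ∫⁻ w, ‖m (w + δ • e) - m w‖ₑ ≤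
        B * ENNReal.ofReal (δ ^ (1 / p').toReal) := by
    intro e he
    have hnorm : ‖e‖ = 1 := by rcases he with rfl | rfl <;> simp [Prod.norm_def]
    refine hcpt.exists_lintegral_shift_le hnorm fun q hq => ?_
    obtain ⟨n, f, γ, E, α, A, -, hstd, hα, ⟨U, hU, hmU⟩, hN⟩ := hloc q hq
    have hctrl : ShiftControl (stdFun n f γ E) e := by
      rcases he with rfl | rfl
      exacts [hstd.shiftControl.1, hstd.shiftControl.2]
    obtain ⟨r, hr, hrU, B, hB, hbound⟩ := hα.exists_lintegral_shift_le
      (stdFun_nonneg n f γ E) hnorm hp hctrl hstd.exists_measurable hN hU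
    refine ⟨r, hr, B, hB, fun δ hδ => ?_⟩
    have hSm : MeasurableSet
        {w | w ∈ ball (0 : ℝ × ℝ) r ∧ w + δ • e ∈ ball (0 : ℝ × ℝ) r} :=
      measurableSet_ball.inter ((measurable_id.add_const _) measurableSet_ball)
    rw [hκ]
    refine (setLIntegral_congr_fun hSm fun w hw => ?_).trans_le (hbound δ hδ)
    simp only [hmU _ (hrU hw.1), hmU _ (hrU hw.2)]
  obtain ⟨C, hC, hK⟩ := exists_norm_Kfull_le ENNReal.toReal_nonneg hmod
  have hlog : 0 < Real.log 2 := Real.log_pos one_lt_two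
  refine ⟨max C (C / Real.log 2), lt_max_of_lt_left hC, fun t u => ?_⟩
  have hnn : 0 ≤ nrm2 (t, u) := Real.sqrt_nonneg _
  refine ⟨fun _ => (hK t u).trans (by gcongr; exact le_max_left _ _), ?_⟩
  rintro rfl
  have hκ1 : (1 / p').toReal = 1 := by rw [hκ]; simp
  have h := hK t u
  rw [hκ1, Real.rpow_neg_one] at h
  have hl : Real.log 2 ≤ Real.log (2 + nrm2 (t, u)) :=
    Real.log_le_log two_pos (by linarith)
  calc ‖Kfull m t u‖ ≤ C * (2 + nrm2 (t, u))⁻¹ := h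
    _ = C / Real.log 2 * (2 + nrm2 (t, u))⁻¹ * Real.log 2 := by field_simp
    _ ≤ max C (C / Real.log 2) * (2 + nrm2 (t, u))⁻¹ * Real.log (2 + nrm2 (t, u)) := by
        gcongr
        exact le_max_right _ _
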